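/- arXiv:1810.00150 — 9 statements merged into one kernel-verified Lean document; each statement's English description precedes it below -/
import Mathlib

section
/- Let g_1,…,g_n be vectors in ℝ^d with n ≥ 2 and 1 ≤ m ≤ n. With ĝ_I = (1/m)∑_{i∈I} g_i for a uniformly random size-m subset I of {1,…,n}, g = (1/n)∑_{i=1}^n g_i, and γ = max_{i,j∈{1,…,n}} |⟨g_i, g_j⟩|, the following holds: 0 ≤ E‖ĝ_I‖² − ‖g‖² ≤ 2(n−m)γ/(m(n−1)). -/
open Finset RealInnerProductSpace

/-- The double inclusion count underlying second moments of sums over a uniformly random subset of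
fixed cardinality. -/
theorem Finset.sum_powersetCard_sum_sum {α : Type*} [Fintype α] [DecidableEq α] (m : ℕ)
    (hm : 1 ≤ m) (hmn : m ≤ Fintype.card α) (hn : 2 ≤ Fintype.card α) (f : α → α → ℝ) :
    (((Fintype.card α).choose m : ℝ))⁻¹ *
        ∑ I ∈ powersetCard m (univ : Finset α), ∑ i ∈ I, ∑ j ∈ I, f i j =
      (m : ℝ) * (((Fintype.card α : ℝ) - m) * ∑ i, f i i + ((m : ℝ) - 1) * ∑ i, ∑ j, f i j) /
        ((Fintype.card α : ℝ) * ((Fintype.card α : ℝ) - 1)) := by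
  generalize hN : Fintype.card α = n at *
  have hcount : ∀ t : Finset α, #t ≤ m →
      (#{I ∈ powersetCard m (univ : Finset α) | t ⊆ I}) = (n - #t).choose (m - #t) := by
    intro t ht
    rw [card_filter_powersetCard_subset t univ m (subset_univ t) ht, card_univ, hN]
  have hswap : ∑ I ∈ powersetCard m (univ : Finset α), ∑ i ∈ I, ∑ j ∈ I, f i j =
      ∑ i, ∑ j, (#{I ∈ powersetCard m (univ : Finset α) | {i, j} ⊆ I} : ℝ) * f i j := by
    have hI : ∀ I : Finset α, ∑ i ∈ I, ∑ j ∈ I, f i j =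
        ∑ i, ∑ j, if {i, j} ⊆ I then f i j else 0 := by
      intro I
      simp [insert_subset_iff, ite_and, sum_ite_irrel]
    simp_rw [hI]
    rw [sum_comm]
    refine sum_congr rfl fun i _ => ?_
    rw [sum_comm]
    refine sum_congr rfl fun j _ => ?_
    rw [← sum_filter, sum_const, nsmul_eq_mul]
  have hn0 : (n : ℝ) ≠ 0 := by positivity
  have hn1 : (n : ℝ) - 1 ≠ 0 := by
    have : (2 : ℝ) ≤ n := by exact_mod_cast hn
    linarith
  have hC : (n.choose m : ℝ) ≠ 0 := by exact_mod_cast (Nat.choose_pos hmn).ne'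
  have hpair : ∀ i j : α, (#{I ∈ powersetCard m (univ : Finset α) | {i, j} ⊆ I} : ℝ) =
      (n.choose m : ℝ) * (m / (n * (n - 1))) *
        ((m - 1) + if i = j then (n : ℝ) - m else 0) := by
    obtain ⟨k, rfl⟩ : ∃ k, n = k + 2 := ⟨n - 2, by omega⟩
    obtain ⟨l, rfl⟩ : ∃ l, m = l + 1 := ⟨m - 1, by omega⟩
    have h1 : ((k : ℝ) + 2) * (k + 1).choose l = (k + 2).choose (l + 1) * (l + 1) := by
      exact_mod_cast Nat.add_one_mul_choose_eq (k + 1) l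
    intro i j
    push_cast at hn0 hn1 ⊢
    have hk : (k : ℝ) + 1 ≠ 0 := by positivity
    have hk' : (k : ℝ) + 2 - 1 = k + 1 := by ring
    by_cases hij : i = j
    · subst hij
      rw [hcount _ (by simp)]
      simp only [pair_eq_singleton, card_singleton, if_true, Nat.add_sub_cancel,
        show k + 2 - 1 = k + 1 from rfl]
      rw [hk']
      field_simp
      linear_combination ((k : ℝ) + 1) * h1
    · rw [if_neg hij, hk']
      rcases l with _ | l
      · have : #{I ∈ powersetCard (0 + 1) (univ : Finset α) | {i, j} ⊆ I} = 0 := by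
          rw [card_eq_zero, filter_eq_empty_iff]
          intro I hI hsub
          have := card_le_card hsub
          rw [card_pair hij, (mem_powersetCard.1 hI).2] at this
          omega
        rw [this]
        simp
      · have h2 : ((k : ℝ) + 1) * k.choose l = (k + 1).choose (l + 1) * (l + 1) := by
          exact_mod_cast Nat.add_one_mul_choose_eq k l
        rw [hcount _ (by rw [card_pair hij]; omega), card_pair hij]
        simp only [show k + 2 - 2 = k from rfl, show l + 1 + 1 - 2 = l from rfl]
        push_cast at h1 ⊢
        field_simp
        linear_combination ((k : ℝ) + 2) * h2 + ((l : ℝ) + 1) * h1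
  rw [hswap]
  simp_rw [hpair, mul_assoc, ← mul_sum, add_mul, sum_add_distrib, ite_mul, zero_mul, sum_ite_eq,
    mem_univ, if_true, ← mul_sum]
  field_simp
  ring

/-- The variance identity for sampling without replacement. -/
theorem expectation_sq_norm_minibatch_sub {E : Type*} [NormedAddCommGroup E]
    [InnerProductSpace ℝ E] (n m : ℕ) (hn : 2 ≤ n) (hm : 1 ≤ m) (hmn : m ≤ n) (g : Fin n → E) :
    ((n.choose m : ℝ))⁻¹ * ∑ I ∈ powersetCard m (univ : Finset (Fin n)),
          ‖(m : ℝ)⁻¹ • ∑ i ∈ I, g i‖ ^ 2 - ‖(n : ℝ)⁻¹ • ∑ i, g i‖ ^ 2 =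
      ((n : ℝ) - m) / (m * (n - 1)) *
        ((∑ i, ‖g i‖ ^ 2) / n - ‖∑ i, g i‖ ^ 2 / n ^ 2) := by
  have hn2 : (2 : ℝ) ≤ n := by exact_mod_cast hn
  have hn0 : (n : ℝ) ≠ 0 := by positivity
  have hn1 : (n : ℝ) - 1 ≠ 0 := by linarith
  have hm0 : (m : ℝ) ≠ 0 := by positivity
  have hsq : ∀ I : Finset (Fin n), ‖∑ i ∈ I, g i‖ ^ 2 = ∑ i ∈ I, ∑ j ∈ I, ⟪g i, g j⟫ := by
    intro I
    simp_rw [← real_inner_self_eq_norm_sq, sum_inner, inner_sum]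
  have key := sum_powersetCard_sum_sum m hm (by simpa using hmn) (by simpa using hn)
    fun i j : Fin n => ⟪g i, g j⟫
  simp only [Fintype.card_fin, ← hsq, real_inner_self_eq_norm_sq] at key
  simp_rw [norm_smul, mul_pow, ← mul_sum]
  rw [mul_left_comm, key]
  simp only [norm_inv, Real.norm_natCast]
  field_simp
  ring

/-- For vectors `g 1, …, g n` in `ℝ^d`, with `ĝ_I = (1/m) ∑_{i ∈ I} g i` for a
uniformly random size-`m` subset `I` of `{1,…,n}`, `g = (1/n) ∑ g i`, and
`γ = max_{i,j} |⟨g i, g j⟩|`, we have `0 ≤ E‖ĝ_I‖² − ‖g‖² ≤ 2(n−m)γ/(m(n−1))`. -/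
theorem minibatch_sq_norm_expectation_bounds
    (d n m : ℕ) (hn : 2 ≤ n) (hm1 : 1 ≤ m) (hmn : m ≤ n)
    (g : Fin n → EuclideanSpace ℝ (Fin d)) (γ : ℝ)
    (hγ : IsGreatest {x : ℝ | ∃ i j : Fin n, x = abs ⟪g i, g j⟫} γ) :
    0 ≤ ((n.choose m : ℝ))⁻¹ *
          ∑ I ∈ Finset.powersetCard m (Finset.univ : Finset (Fin n)),
            ‖(m : ℝ)⁻¹ • ∑ i ∈ I, g i‖ ^ 2
        - ‖(n : ℝ)⁻¹ • ∑ i, g i‖ ^ 2 ∧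
    ((n.choose m : ℝ))⁻¹ *
          ∑ I ∈ Finset.powersetCard m (Finset.univ : Finset (Fin n)),
            ‖(m : ℝ)⁻¹ • ∑ i ∈ I, g i‖ ^ 2
        - ‖(n : ℝ)⁻¹ • ∑ i, g i‖ ^ 2
      ≤ 2 * ((n : ℝ) - (m : ℝ)) * γ / ((m : ℝ) * ((n : ℝ) - 1)) := by
  have hn2 : (2 : ℝ) ≤ n := by exact_mod_cast hn
  have hm0 : (0 : ℝ) < m := by exact_mod_cast hm1
  have hn0 : (0 : ℝ) < n := by linarith
  have hn1 : (0 : ℝ) < n - 1 := by linarith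
  have hmn' : (0 : ℝ) ≤ n - m := sub_nonneg.2 (by exact_mod_cast hmn)
  have hbound : ∀ i, ‖g i‖ ^ 2 ≤ γ := by
    intro i
    rw [← real_inner_self_eq_norm_sq]
    exact (le_abs_self _).trans (hγ.2 ⟨i, i, rfl⟩)
  have hγ0 : 0 ≤ γ := (sq_nonneg _).trans (hbound ⟨0, by omega⟩)
  have hcauchy : ‖∑ i, g i‖ ^ 2 ≤ n * ∑ i, ‖g i‖ ^ 2 := by
    calc ‖∑ i, g i‖ ^ 2 ≤ (∑ i, ‖g i‖) ^ 2 := by gcongr; exact norm_sum_le _ _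
      _ ≤ n * ∑ i, ‖g i‖ ^ 2 := by
        simpa using sq_sum_le_card_mul_sum_sq (s := univ) (f := fun i => ‖g i‖)
  have hsum : (∑ i, ‖g i‖ ^ 2) / n ≤ γ := by
    rw [div_le_iff₀ hn0, mul_comm]
    simpa using sum_le_card_nsmul univ (fun i => ‖g i‖ ^ 2) γ fun i _ => hbound i
  rw [expectation_sq_norm_minibatch_sub n m hn hm1 hmn g]
  constructor
  · refine mul_nonneg (by positivity) ?_
    rw [sub_nonneg, div_le_div_iff₀ (by positivity) hn0]
    nlinarith
  · have hS : 0 ≤ ‖∑ i, g i‖ ^ 2 / (n : ℝ) ^ 2 := by positivity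
    calc ((n : ℝ) - m) / (m * (n - 1)) * ((∑ i, ‖g i‖ ^ 2) / n - ‖∑ i, g i‖ ^ 2 / n ^ 2)
        ≤ ((n : ℝ) - m) / (m * (n - 1)) * (2 * γ) := by
          gcongr
          linarith
      _ = 2 * ((n : ℝ) - m) * γ / (m * (n - 1)) := by ring
end

section
/- Let g_1,…,g_n be vectors in ℝ^d with n ≥ 2, 1 ≤ m ≤ n, and suppose g = (1/n)∑_{i=1}^n g_i is nonzero. With ĝ_I = (1/m)∑_{i∈I} g_i for a uniformly random size-m subset I of {1,…,n} and γ = max_{i,j} |⟨g_i, g_j⟩|, one has 0 ≤ E‖ĝ_I‖ − ‖g‖ ≤ (2(n−m)/(m(n−1))) · γ/(E‖ĝ_I‖ + ‖g‖) ≤ (n−m)γ/(m(n−1)‖g‖). -/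
open Finset RealInnerProductSpace

/-- Each point lies in the fraction `m / n` of the `m`-subsets of an `n`-set. -/
lemma card_mul_card_filter_mem_powersetCard {α : Type*} [Fintype α] [DecidableEq α] {m : ℕ}
    (hm : 1 ≤ m) (i : α) :
    Fintype.card α * #{I ∈ powersetCard m (univ : Finset α) | i ∈ I} =
      m * (Fintype.card α).choose m := by
  have hcard : #{I ∈ powersetCard m (univ : Finset α) | i ∈ I} =
      (Fintype.card α - 1).choose (m - 1) := by
    simpa using card_filter_powersetCard_subset {i} (univ : Finset α) m (subset_univ _) (by simpa)
  have hpos : 1 ≤ Fintype.card α := Fintype.card_pos_iff.mpr ⟨i⟩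
  obtain ⟨k, rfl⟩ := Nat.exists_eq_add_of_le' hm
  obtain ⟨N, hN⟩ := Nat.exists_eq_add_of_le' hpos
  rw [hcard, hN, mul_comm (k + 1)]
  exact Nat.add_one_mul_choose_eq N k

/-- Two distinct points lie together in the fraction `m (m - 1) / (n (n - 1))` of the `m`-subsets
of an `n`-set. -/
lemma card_mul_card_filter_mem_mem_powersetCard {α : Type*} [Fintype α] [DecidableEq α] {m : ℕ}
    (hm : 1 ≤ m) {i j : α} (hij : i ≠ j) :
    Fintype.card α * (Fintype.card α - 1) *
        #{I ∈ powersetCard m (univ : Finset α) | i ∈ I ∧ j ∈ I} =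
      m * (m - 1) * (Fintype.card α).choose m := by
  have hpair : #({i, j} : Finset α) = 2 := card_pair hij
  rcases hm.eq_or_lt with rfl | hm2
  · have : #{I ∈ powersetCard 1 (univ : Finset α) | i ∈ I ∧ j ∈ I} = 0 := by
      simp only [card_eq_zero, filter_eq_empty_iff, mem_powersetCard_univ]
      rintro I hI ⟨hi, hj⟩
      exact hij (card_le_one.mp hI.le i hi j hj)
    simp [this]
  · have hcard : #{I ∈ powersetCard m (univ : Finset α) | i ∈ I ∧ j ∈ I} =
        (Fintype.card α - 2).choose (m - 2) := by
      have := card_filter_powersetCard_subset {i, j} (univ : Finset α) m (subset_univ _)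
        (by rw [hpair]; exact hm2)
      simpa [hpair, insert_subset_iff] using this
    have hpos : 2 ≤ Fintype.card α := hpair ▸ card_le_univ _
    obtain ⟨k, rfl⟩ : ∃ k, m = k + 2 := Nat.exists_eq_add_of_le' hm2
    obtain ⟨N, hN⟩ := Nat.exists_eq_add_of_le' hpos
    rw [hcard, hN]
    have h₁ := Nat.add_one_mul_choose_eq N k
    have h₂ := Nat.add_one_mul_choose_eq (N + 1) (k + 1)
    simp only [Nat.add_sub_cancel, Nat.reduceSubDiff]
    calc (N + 2) * (N + 1) * N.choose k
        = (N + 1 + 1) * (N + 1).choose (k + 1) * (k + 1) := by rw [mul_assoc, h₁, mul_assoc]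
      _ = _ := by rw [h₂]; ring

section Moments

variable {α E : Type*} [Fintype α] [DecidableEq α] [NormedAddCommGroup E] [InnerProductSpace ℝ E]

lemma card_smul_sum_powersetCard_sum {m : ℕ} (hm : 1 ≤ m) (g : α → E) :
    (Fintype.card α : ℝ) • ∑ I ∈ powersetCard m (univ : Finset α), ∑ i ∈ I, g i =
      ((m : ℝ) * (Fintype.card α).choose m) • ∑ i, g i := by
  have hswap : ∑ I ∈ powersetCard m (univ : Finset α), ∑ i ∈ I, g i =
      ∑ i, (#{I ∈ powersetCard m (univ : Finset α) | i ∈ I} : ℝ) • g i := by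
    rw [sum_comm' (t' := univ) (s' := fun i ↦ {I ∈ powersetCard m (univ : Finset α) | i ∈ I})
      (by simp)]
    simp [Nat.cast_smul_eq_nsmul]
  rw [hswap, smul_sum, smul_sum]
  refine sum_congr rfl fun i _ ↦ ?_
  rw [smul_smul]
  congr 1
  exact_mod_cast card_mul_card_filter_mem_powersetCard hm i

/-- The second moment of the sum over a uniformly random `m`-subset. -/
lemma card_mul_sum_powersetCard_norm_sum_sq {m : ℕ} (hm : 1 ≤ m) (hα : 1 ≤ Fintype.card α)
    (g : α → E) :
    (Fintype.card α : ℝ) * (Fintype.card α - 1) *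
        ∑ I ∈ powersetCard m (univ : Finset α), ‖∑ i ∈ I, g i‖ ^ 2 =
      m * (Fintype.card α).choose m *
        ((m - 1) * ‖∑ i, g i‖ ^ 2 + (Fintype.card α - m) * ∑ i, ‖g i‖ ^ 2) := by
  have hswap : ∑ I ∈ powersetCard m (univ : Finset α), ‖∑ i ∈ I, g i‖ ^ 2 =
      ∑ i, ∑ j, (#{I ∈ powersetCard m (univ : Finset α) | i ∈ I ∧ j ∈ I} : ℝ) * ⟪g i, g j⟫ := by
    simp only [← real_inner_self_eq_norm_sq, sum_inner, inner_sum]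
    rw [sum_comm' (t' := univ) (s' := fun i ↦ {I ∈ powersetCard m (univ : Finset α) | i ∈ I})
      (by simp)]
    refine sum_congr rfl fun i _ ↦ ?_
    rw [sum_comm' (t' := univ)
      (s' := fun j ↦ {I ∈ powersetCard m (univ : Finset α) | i ∈ I ∧ j ∈ I})
      (by simp [and_assoc])]
    simp [real_inner_comm]
  have hcount (i j : α) : (Fintype.card α : ℝ) * (Fintype.card α - 1) *
      #{I ∈ powersetCard m (univ : Finset α) | i ∈ I ∧ j ∈ I} =
        m * (Fintype.card α).choose m *
          ((m - 1) + if i = j then (Fintype.card α - m : ℝ) else 0) := by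
    rcases eq_or_ne i j with rfl | hij
    · have h := congrArg (Nat.cast (R := ℝ)) (card_mul_card_filter_mem_powersetCard hm i)
      push_cast at h
      simp only [and_self, if_true]
      linear_combination ((Fintype.card α : ℝ) - 1) * h
    · have h := congrArg (Nat.cast (R := ℝ)) (card_mul_card_filter_mem_mem_powersetCard hm hij)
      push_cast [Nat.cast_sub hm, Nat.cast_sub hα] at h
      simp only [hij, if_false]
      linear_combination h
  have hnorm : ‖∑ i, g i‖ ^ 2 = ∑ i, ∑ j, ⟪g i, g j⟫ := by
    simp only [← real_inner_self_eq_norm_sq, sum_inner, inner_sum]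
    exact sum_comm
  rw [hswap, hnorm]
  simp only [mul_sum, ← mul_assoc, hcount]
  simp only [mul_add, add_mul, sum_add_distrib, mul_sum, mul_assoc, ite_mul, mul_ite, zero_mul,
    mul_zero, sum_ite_eq, mem_univ, if_true, real_inner_self_eq_norm_sq]

end Moments

/-- With `g ≠ 0`, the expected minibatch gradient norm satisfies
`0 ≤ E‖ĝ_I‖ − ‖g‖ ≤ (2(n−m)/(m(n−1))) · γ/(E‖ĝ_I‖ + ‖g‖) ≤ (n−m)γ/(m(n−1)‖g‖)`. -/
theorem minibatch_norm_expectation_bounds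
    (d n m : ℕ) (hn : 2 ≤ n) (hm1 : 1 ≤ m) (hmn : m ≤ n)
    (g : Fin n → EuclideanSpace ℝ (Fin d))
    (hg : (n : ℝ)⁻¹ • ∑ i, g i ≠ 0) (γ : ℝ)
    (hγ : IsGreatest {x : ℝ | ∃ i j : Fin n, x = abs ⟪g i, g j⟫} γ) :
    0 ≤ ((n.choose m : ℝ))⁻¹ *
          ∑ I ∈ Finset.powersetCard m (Finset.univ : Finset (Fin n)),
            ‖(m : ℝ)⁻¹ • ∑ i ∈ I, g i‖
        - ‖(n : ℝ)⁻¹ • ∑ i, g i‖ ∧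
    ((n.choose m : ℝ))⁻¹ *
          ∑ I ∈ Finset.powersetCard m (Finset.univ : Finset (Fin n)),
            ‖(m : ℝ)⁻¹ • ∑ i ∈ I, g i‖
        - ‖(n : ℝ)⁻¹ • ∑ i, g i‖
      ≤ (2 * ((n : ℝ) - (m : ℝ)) / ((m : ℝ) * ((n : ℝ) - 1))) *
          (γ / (((n.choose m : ℝ))⁻¹ *
              ∑ I ∈ Finset.powersetCard m (Finset.univ : Finset (Fin n)),
                ‖(m : ℝ)⁻¹ • ∑ i ∈ I, g i‖
            + ‖(n : ℝ)⁻¹ • ∑ i, g i‖)) ∧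
    (2 * ((n : ℝ) - (m : ℝ)) / ((m : ℝ) * ((n : ℝ) - 1))) *
          (γ / (((n.choose m : ℝ))⁻¹ *
              ∑ I ∈ Finset.powersetCard m (Finset.univ : Finset (Fin n)),
                ‖(m : ℝ)⁻¹ • ∑ i ∈ I, g i‖
            + ‖(n : ℝ)⁻¹ • ∑ i, g i‖))
      ≤ ((n : ℝ) - (m : ℝ)) * γ /
          ((m : ℝ) * ((n : ℝ) - 1) * ‖(n : ℝ)⁻¹ • ∑ i, g i‖) := by
  have hn' : (2 : ℝ) ≤ n := by exact_mod_cast hn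
  have hm' : (1 : ℝ) ≤ m := by exact_mod_cast hm1
  have hmn' : (m : ℝ) ≤ n := by exact_mod_cast hmn
  have hC : (0 : ℝ) < n.choose m := by exact_mod_cast Nat.choose_pos hmn
  have hγi (i : Fin n) : ‖g i‖ ^ 2 ≤ γ := by
    rw [← real_inner_self_eq_norm_sq]
    exact (le_abs_self _).trans (hγ.2 ⟨i, i, rfl⟩)
  have hγ0 : 0 ≤ γ := (sq_nonneg _).trans (hγi ⟨0, by omega⟩)
  have hG : 0 < ‖(n : ℝ)⁻¹ • ∑ i, g i‖ := norm_pos_iff.mpr hg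
  have hfirst := card_smul_sum_powersetCard_sum hm1 g
  have hsecond := card_mul_sum_powersetCard_norm_sum_sq hm1 (by simp; omega) g
  rw [Fintype.card_fin] at hfirst hsecond
  have hmean : (n : ℝ)⁻¹ • ∑ i, g i = (n.choose m : ℝ)⁻¹ •
      ∑ I ∈ powersetCard m (univ : Finset (Fin n)), (m : ℝ)⁻¹ • ∑ i ∈ I, g i := by
    rw [← smul_sum, smul_smul, ← smul_right_inj (r := (n : ℝ) * m * n.choose m) (by positivity),
      smul_smul, smul_smul]
    convert hfirst.symm using 2 <;> field_simp
  have hlower : ‖(n : ℝ)⁻¹ • ∑ i, g i‖ ≤ (n.choose m : ℝ)⁻¹ *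
      ∑ I ∈ powersetCard m (univ : Finset (Fin n)), ‖(m : ℝ)⁻¹ • ∑ i ∈ I, g i‖ := by
    rw [hmean, norm_smul, Real.norm_of_nonneg (by positivity)]
    gcongr
    exact norm_sum_le _ _
  have hsq : ‖∑ i, g i‖ ^ 2 = n ^ 2 * ‖(n : ℝ)⁻¹ • ∑ i, g i‖ ^ 2 := by
    rw [norm_smul, Real.norm_of_nonneg (by positivity)]
    field_simp
  have hjensen : ((n.choose m : ℝ)⁻¹ *
      ∑ I ∈ powersetCard m (univ : Finset (Fin n)), ‖(m : ℝ)⁻¹ • ∑ i ∈ I, g i‖) ^ 2 ≤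
      (n.choose m : ℝ)⁻¹ * ((m : ℝ)⁻¹ ^ 2 *
        ∑ I ∈ powersetCard m (univ : Finset (Fin n)), ‖∑ i ∈ I, g i‖ ^ 2) := by
    have h := sq_sum_le_card_mul_sum_sq (s := powersetCard m (univ : Finset (Fin n)))
      (f := fun I ↦ ‖(m : ℝ)⁻¹ • ∑ i ∈ I, g i‖)
    simp only [card_powersetCard, card_univ, Fintype.card_fin] at h
    have hscale : ∑ I ∈ powersetCard m (univ : Finset (Fin n)), ‖(m : ℝ)⁻¹ • ∑ i ∈ I, g i‖ ^ 2 =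
        (m : ℝ)⁻¹ ^ 2 * ∑ I ∈ powersetCard m (univ : Finset (Fin n)), ‖∑ i ∈ I, g i‖ ^ 2 := by
      rw [mul_sum]
      refine sum_congr rfl fun I _ ↦ ?_
      rw [norm_smul, Real.norm_of_nonneg (by positivity), mul_pow]
    rw [← hscale, mul_pow]
    refine (mul_le_mul_of_nonneg_left h (by positivity)).trans_eq ?_
    field_simp
  have hsum : ∑ i, ‖g i‖ ^ 2 ≤ n * γ := by
    simpa using sum_le_card_nsmul univ (fun i ↦ ‖g i‖ ^ 2) γ fun i _ ↦ hγi i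
  rw [hsq] at hsecond
  set X := (n.choose m : ℝ)⁻¹ *
    ∑ I ∈ powersetCard m (univ : Finset (Fin n)), ‖(m : ℝ)⁻¹ • ∑ i ∈ I, g i‖
  set G := ‖(n : ℝ)⁻¹ • ∑ i, g i‖
  set S := ∑ I ∈ powersetCard m (univ : Finset (Fin n)), ‖∑ i ∈ I, g i‖ ^ 2
  have hn1 : (0 : ℝ) < n - 1 := by linarith
  have hnm : (0 : ℝ) ≤ n - m := by linarith
  have hS : (n.choose m : ℝ)⁻¹ * ((m : ℝ)⁻¹ ^ 2 * S) =
      ((m - 1) * (n ^ 2 * G ^ 2) + (n - m) * ∑ i, ‖g i‖ ^ 2) / (m * (n * (n - 1))) := by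
    field_simp
    linear_combination hsecond
  have hvar : X ^ 2 - G ^ 2 ≤ (n - m) * γ / (m * (n - 1)) := by
    rw [hS, le_div_iff₀ (by positivity)] at hjensen
    rw [le_div_iff₀ (by positivity)]
    refine le_of_mul_le_mul_left ?_ (show (0 : ℝ) < n by linarith)
    have h₁ := mul_le_mul_of_nonneg_left hsum hnm
    have h₂ : 0 ≤ n * (n - m) * G ^ 2 := by positivity
    linarith
  refine ⟨sub_nonneg.mpr hlower, ?_, ?_⟩
  · rw [← mul_div_assoc, le_div_iff₀ (by linarith)]
    have h : 0 ≤ (n - m) * γ / (m * (n - 1)) := by positivity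
    calc (X - G) * (X + G) = X ^ 2 - G ^ 2 := by ring
      _ ≤ 2 * ((n - m) * γ / (m * (n - 1))) := by linarith
      _ = 2 * (n - m) / (m * (n - 1)) * γ := by ring
  · calc 2 * ((n : ℝ) - m) / (m * (n - 1)) * (γ / (X + G))
        ≤ 2 * (n - m) / (m * (n - 1)) * (γ / (2 * G)) := by
          gcongr
          linarith
      _ = (n - m) * γ / (m * (n - 1) * G) := by field_simp
end

section
/- Let g_1,…,g_n be vectors in ℝ^d with n ≥ 2 and 1 ≤ m ≤ n. With ĝ_I = (1/m)∑_{i∈I} g_i for a uniformly random size-m subset I of {1,…,n} and γ = max_{i,j} |⟨g_i, g_j⟩|, the variance of the minibatch gradient norm satisfies Var(‖ĝ_I‖) = E‖ĝ_I‖² − (E‖ĝ_I‖)² ≤ 2(n−m)γ/(m(n−1)). -/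
open Finset RealInnerProductSpace

theorem card_filter_subset_powersetCard_univ_mul_choose {ι : Type*} [Fintype ι] [DecidableEq ι]
    (m : ℕ) (s : Finset ι) :
    #{I ∈ powersetCard m (univ : Finset ι) | s ⊆ I} * (Fintype.card ι).choose #s =
      (Fintype.card ι).choose m * m.choose #s := by
  by_cases h : #s ≤ m
  · rw [card_filter_powersetCard_subset s univ m (subset_univ s) h, Nat.choose_mul h, card_univ,
      mul_comm]
  · have hempty : {I ∈ powersetCard m (univ : Finset ι) | s ⊆ I} = ∅ := by
      refine filter_eq_empty_iff.2 fun I hI hsI => h ?_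
      rw [← mem_powersetCard_univ.1 hI]
      exact card_le_card hsI
    rw [hempty, Nat.choose_eq_zero_of_lt (not_le.1 h)]
    simp

theorem card_mul_sum_powersetCard_univ_sum {ι E : Type*} [Fintype ι] [DecidableEq ι]
    [AddCommGroup E] [Module ℝ E] (m : ℕ) (g : ι → E) :
    (Fintype.card ι : ℝ) • ∑ I ∈ powersetCard m (univ : Finset ι), ∑ i ∈ I, g i =
      ((Fintype.card ι).choose m * m : ℝ) • ∑ i, g i := by
  have hswap : ∑ I ∈ powersetCard m (univ : Finset ι), ∑ i ∈ I, g i =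
      ∑ i, (#{I ∈ powersetCard m (univ : Finset ι) | {i} ⊆ I} : ℝ) • g i := by
    rw [sum_comm' (t' := univ) (s' := fun i => {I ∈ powersetCard m univ | {i} ⊆ I}) (by simp)]
    simp [Nat.cast_smul_eq_nsmul]
  rw [hswap, smul_sum, smul_sum]
  refine sum_congr rfl fun i _ => ?_
  have h := card_filter_subset_powersetCard_univ_mul_choose m ({i} : Finset ι)
  simp only [card_singleton, Nat.choose_one_right] at h
  rw [smul_smul, mul_comm]
  congr 1
  exact_mod_cast h

theorem mul_sum_powersetCard_univ_norm_sum_sq {ι E : Type*} [Fintype ι] [DecidableEq ι]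
    [NormedAddCommGroup E] [InnerProductSpace ℝ E] (m : ℕ) (g : ι → E) :
    (Fintype.card ι * (Fintype.card ι - 1) : ℝ) *
        ∑ I ∈ powersetCard m (univ : Finset ι), ‖∑ i ∈ I, g i‖ ^ 2 =
      (Fintype.card ι).choose m * m *
        ((Fintype.card ι - m) * ∑ i, ‖g i‖ ^ 2 + (m - 1) * ‖∑ i, g i‖ ^ 2) := by
  have hexpand (I : Finset ι) : ‖∑ i ∈ I, g i‖ ^ 2 = ∑ i ∈ I, ∑ j ∈ I, ⟪g i, g j⟫ := by
    rw [← real_inner_self_eq_norm_sq, sum_inner]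
    simp_rw [inner_sum]
  have hswap : ∑ I ∈ powersetCard m (univ : Finset ι), ‖∑ i ∈ I, g i‖ ^ 2 =
      ∑ i, ∑ j, (#{I ∈ powersetCard m (univ : Finset ι) | {i, j} ⊆ I} : ℝ) * ⟪g i, g j⟫ := by
    have hI (I : Finset ι) : ‖∑ i ∈ I, g i‖ ^ 2 =
        ∑ i, ∑ j, if {i, j} ⊆ I then ⟪g i, g j⟫ else 0 := by
      rw [hexpand]
      simp [insert_subset_iff, ite_and]
    simp_rw [hI]
    rw [sum_comm]
    refine sum_congr rfl fun i _ => ?_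
    rw [sum_comm]
    refine sum_congr rfl fun j _ => ?_
    rw [← sum_filter, sum_const, nsmul_eq_mul]
  have hcoeff (i j : ι) : (Fintype.card ι * (Fintype.card ι - 1) : ℝ) *
      #{I ∈ powersetCard m (univ : Finset ι) | {i, j} ⊆ I} =
      (Fintype.card ι).choose m * m *
        ((Fintype.card ι - m) * (if i = j then 1 else 0) + (m - 1)) := by
    have h := congrArg (Nat.cast : ℕ → ℝ)
      (card_filter_subset_powersetCard_univ_mul_choose m ({i, j} : Finset ι))
    by_cases hij : i = j
    · subst hij
      simp only [pair_eq_singleton, card_singleton, Nat.choose_one_right, Nat.cast_mul] at h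
      simp only [pair_eq_singleton, if_true]
      linear_combination ((Fintype.card ι : ℝ) - 1) * h
    · rw [card_pair hij] at h
      simp only [Nat.cast_mul, Nat.cast_choose_two] at h
      simp only [hij, if_false]
      linear_combination 2 * h
  have hdiag : ∑ i, ‖g i‖ ^ 2 = ∑ i, ∑ j, (if i = j then (1 : ℝ) else 0) * ⟪g i, g j⟫ := by
    simp
  rw [hswap, hexpand univ, hdiag]
  simp only [mul_sum, ← sum_add_distrib]
  refine sum_congr rfl fun i _ => sum_congr rfl fun j _ => ?_
  linear_combination ⟪g i, g j⟫ * hcoeff i j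

/-- The variance of the minibatch gradient norm satisfies
`Var(‖ĝ_I‖) = E‖ĝ_I‖² − (E‖ĝ_I‖)² ≤ 2(n−m)γ/(m(n−1))`. -/
theorem minibatch_norm_variance_bound
    (d n m : ℕ) (hn : 2 ≤ n) (hm1 : 1 ≤ m) (hmn : m ≤ n)
    (g : Fin n → EuclideanSpace ℝ (Fin d)) (γ : ℝ)
    (hγ : IsGreatest {x : ℝ | ∃ i j : Fin n, x = abs ⟪g i, g j⟫} γ) :
    ((n.choose m : ℝ))⁻¹ *
          ∑ I ∈ Finset.powersetCard m (Finset.univ : Finset (Fin n)),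
            ‖(m : ℝ)⁻¹ • ∑ i ∈ I, g i‖ ^ 2
        - (((n.choose m : ℝ))⁻¹ *
            ∑ I ∈ Finset.powersetCard m (Finset.univ : Finset (Fin n)),
              ‖(m : ℝ)⁻¹ • ∑ i ∈ I, g i‖) ^ 2
      ≤ 2 * ((n : ℝ) - (m : ℝ)) * γ / ((m : ℝ) * ((n : ℝ) - 1)) := by
  have hn2 : (2 : ℝ) ≤ n := by exact_mod_cast hn
  have hn0 : (0 : ℝ) < n := by linarith
  have hn1 : (0 : ℝ) < n - 1 := by linarith
  have hm0 : (0 : ℝ) < m := by exact_mod_cast hm1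
  have hnm : (0 : ℝ) ≤ n - m := sub_nonneg.2 (by exact_mod_cast hmn)
  have hc : (0 : ℝ) < n.choose m := by exact_mod_cast Nat.choose_pos hmn
  have hγ0 : 0 ≤ γ := by
    obtain ⟨i, j, h⟩ := hγ.1
    exact h ▸ abs_nonneg _
  have hT : ∑ i, ‖g i‖ ^ 2 ≤ n * γ := by
    have h : ∑ i, ‖g i‖ ^ 2 ≤ ∑ _i : Fin n, γ := sum_le_sum fun i _ => by
      rw [← real_inner_self_eq_norm_sq]
      exact (le_abs_self _).trans (hγ.2 ⟨i, i, rfl⟩)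
    simpa using h
  have hmean : (n : ℝ)⁻¹ * ‖∑ i, g i‖ ≤ (n.choose m : ℝ)⁻¹ *
      ∑ I ∈ powersetCard m (univ : Finset (Fin n)), ‖(m : ℝ)⁻¹ • ∑ i ∈ I, g i‖ := by
    have h1 := congrArg norm (card_mul_sum_powersetCard_univ_sum m g)
    rw [Fintype.card_fin, norm_smul, norm_smul, Real.norm_of_nonneg hn0.le,
      Real.norm_of_nonneg (by positivity)] at h1
    have h2 := norm_sum_le (powersetCard m (univ : Finset (Fin n))) fun I => ∑ i ∈ I, g i
    have h3 := mul_le_mul_of_nonneg_left h2 hn0.le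
    rw [h1] at h3
    simp_rw [norm_smul, norm_inv, Real.norm_of_nonneg hm0.le]
    rw [← mul_sum]
    field_simp
    linarith
  have hmean_sq := pow_le_pow_left₀ (by positivity) hmean 2
  have hsq : (n.choose m : ℝ)⁻¹ *
      ∑ I ∈ powersetCard m (univ : Finset (Fin n)), ‖(m : ℝ)⁻¹ • ∑ i ∈ I, g i‖ ^ 2 =
      ((n - m) * ∑ i, ‖g i‖ ^ 2 + (m - 1) * ‖∑ i, g i‖ ^ 2) / (m * (n * (n - 1))) := by
    have h := mul_sum_powersetCard_univ_norm_sum_sq m g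
    rw [Fintype.card_fin] at h
    simp_rw [norm_smul, norm_inv, Real.norm_of_nonneg hm0.le, mul_pow]
    rw [← mul_sum]
    field_simp
    linear_combination h
  have hle : ((n - m) * ∑ i, ‖g i‖ ^ 2 + (m - 1) * ‖∑ i, g i‖ ^ 2) / (m * (n * (n - 1))) -
      ((n : ℝ)⁻¹ * ‖∑ i, g i‖) ^ 2 ≤ (n - m) * γ / (m * (n - 1)) := by
    have hdecomp : ((n - m) * ∑ i, ‖g i‖ ^ 2 + (m - 1) * ‖∑ i, g i‖ ^ 2) / (m * (n * (n - 1))) -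
        ((n : ℝ)⁻¹ * ‖∑ i, g i‖) ^ 2 = (n - m) * γ / (m * (n - 1)) -
        (n - m) * (n * (n * γ - ∑ i, ‖g i‖ ^ 2) + ‖∑ i, g i‖ ^ 2) / (m * n ^ 2 * (n - 1)) := by
      field_simp
      ring
    rw [hdecomp]
    have := sub_nonneg.2 hT
    exact sub_le_self _ (by positivity)
  have hdouble : (n - m) * γ / (m * (n - 1)) ≤ 2 * ((n : ℝ) - m) * γ / (m * (n - 1)) := by
    gcongr
    linarith
  linarith
end

section
/- For each dimension d, let u and v be independent random vectors, each distributed according to the uniform (normalized surface) probability measure on the unit sphere S^{d−1} ⊂ ℝ^d. Then the real random variable √d·⟨u, v⟩ converges in distribution, as d → ∞, to the standard normal distribution N(0,1); equivalently, the pushforward measures of the product measure σ_d ⊗ σ_d under (u,v) ↦ √d·⟨u,v⟩ converge weakly to the Gaussian measure with mean 0 and variance 1 on ℝ. -/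
open MeasureTheory Filter Metric RealInnerProductSpace

/-- The uniform (normalized surface) probability measure on the unit sphere
`S^{d-1} ⊂ ℝ^d`: the rotation-invariant surface measure `volume.toSphere`
normalized to total mass `1`. -/
noncomputable def sphereUniform (d : ℕ) :
    Measure (sphere (0 : EuclideanSpace ℝ (Fin d)) 1) :=
  ((volume : Measure (EuclideanSpace ℝ (Fin d))).toSphere Set.univ)⁻¹ •
    (volume : Measure (EuclideanSpace ℝ (Fin d))).toSphere

open ProbabilityTheory

section RotationInvariant

variable {E : Type*} [NormedAddCommGroup E] [InnerProductSpace ℝ E] [MeasurableSpace E]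

/-- A measure invariant under all linear isometries. -/
def RotationInvariant (μ : Measure E) : Prop :=
  ∀ L : E ≃ₗᵢ[ℝ] E, μ.map L = μ

lemma RotationInvariant.smul {μ : Measure E} (hμ : RotationInvariant μ) (c : ENNReal) :
    RotationInvariant (c • μ) :=
  fun L ↦ by rw [Measure.map_smul, hμ L]

variable [BorelSpace E]

lemma RotationInvariant.integral_inner_eq {μ : Measure E} (hμ : RotationInvariant μ)
    (f : BoundedContinuousFunction ℝ ℝ) {x y : E} (hxy : ‖x‖ = ‖y‖) :
    ∫ v, f ⟪x, v⟫ ∂μ = ∫ v, f ⟪y, v⟫ ∂μ := by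
  set L : E ≃ₗᵢ[ℝ] E := Submodule.reflection (Submodule.span ℝ {x - y})ᗮ
  have hL : L x = y := Submodule.reflection_sub hxy
  nth_rw 2 [← hμ L]
  rw [integral_map (by fun_prop) (Continuous.aestronglyMeasurable (by fun_prop))]
  simp [← hL]

lemma RotationInvariant.integral_prod_inner {μ ν : Measure E} [IsProbabilityMeasure μ]
    [IsProbabilityMeasure ν] (hμ : RotationInvariant μ) (f : BoundedContinuousFunction ℝ ℝ)
    (hν : ∀ᵐ v ∂ν, ‖v‖ = 1) {e : E} (he : ‖e‖ = 1) :
    ∫ v, ∫ u, f ⟪v, u⟫ ∂μ ∂ν = ∫ u, f ⟪e, u⟫ ∂μ := by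
  rw [integral_congr_ae (g := fun _ ↦ ∫ u, f ⟪e, u⟫ ∂μ)]
  · simp
  · filter_upwards [hν] with v hv
    exact hμ.integral_inner_eq f (hv.trans he.symm)

variable [FiniteDimensional ℝ E]

/-- Two rotation-invariant probability measures carried by the unit sphere have the same
one-dimensional projections. -/
lemma RotationInvariant.integral_inner_unique {μ ν : Measure E} [IsProbabilityMeasure μ]
    [IsProbabilityMeasure ν] (hμ : RotationInvariant μ) (hν : RotationInvariant ν)
    (hμ1 : ∀ᵐ v ∂μ, ‖v‖ = 1) (hν1 : ∀ᵐ v ∂ν, ‖v‖ = 1)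
    (f : BoundedContinuousFunction ℝ ℝ) {e : E} (he : ‖e‖ = 1) :
    ∫ u, f ⟪e, u⟫ ∂μ = ∫ v, f ⟪e, v⟫ ∂ν := by
  rw [← hμ.integral_prod_inner f hν1 he, ← hν.integral_prod_inner f hμ1 he,
    integral_integral_swap]
  · simp_rw [real_inner_comm]
  · exact Integrable.of_bound (C := ‖f‖) (Continuous.aestronglyMeasurable (by fun_prop))
      (ae_of_all _ fun p ↦ f.norm_coe_le_norm _)

lemma RotationInvariant.map_normalize {μ : Measure E} (hμ : RotationInvariant μ) :
    RotationInvariant (μ.map fun x ↦ ‖x‖⁻¹ • x) := by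
  intro L
  have hN : Measurable fun x : E ↦ ‖x‖⁻¹ • x := by fun_prop
  nth_rw 2 [← hμ L]
  rw [Measure.map_map (by fun_prop) hN, Measure.map_map hN (by fun_prop)]
  congr 1
  ext x
  simp

lemma rotationInvariant_stdGaussian : RotationInvariant (stdGaussian E) :=
  fun L ↦ stdGaussian_map L

open scoped Pointwise in
lemma rotationInvariant_toSphere_map_coe :
    RotationInvariant ((volume : Measure E).toSphere.map Subtype.val) := by
  intro L
  rw [Measure.map_map (by fun_prop) (by fun_prop)]
  ext s hs
  have hcone : Set.Ioo (0 : ℝ) 1 • (sphere (0 : E) 1 ∩ L ⁻¹' s) =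
      L ⁻¹' (Set.Ioo (0 : ℝ) 1 • (sphere (0 : E) 1 ∩ s)) := by
    ext x
    simp only [Set.mem_smul, Set.mem_inter_iff, Set.mem_preimage, mem_sphere_zero_iff_norm]
    constructor
    · rintro ⟨r, hr, y, ⟨hy, hys⟩, rfl⟩
      exact ⟨r, hr, L y, ⟨by simpa using hy, hys⟩, by simp⟩
    · rintro ⟨r, hr, y, ⟨hy, hys⟩, h⟩
      exact ⟨r, hr, L.symm y, ⟨by simpa using hy, by simpa using hys⟩,
        L.injective (by simpa using h)⟩
  rw [Measure.map_apply (by fun_prop) hs, Measure.map_apply (by fun_prop) hs,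
    Measure.toSphere_apply' _ (hs.preimage (by fun_prop)),
    Measure.toSphere_apply' _ (hs.preimage (by fun_prop)), Set.preimage_comp,
    Subtype.image_preimage_coe, Subtype.image_preimage_coe, hcone,
    L.measurePreserving.measure_preimage_emb L.toHomeomorph.measurableEmbedding]

end RotationInvariant

instance isProbabilityMeasure_sphereUniform (d : ℕ) [NeZero d] :
    IsProbabilityMeasure (sphereUniform d) where
  measure_univ := by
    rw [sphereUniform, Measure.smul_apply, smul_eq_mul, ENNReal.inv_mul_cancel _ (by finiteness)]
    exact Measure.measure_univ_ne_zero.2 (Measure.toSphere_ne_zero _)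

lemma integral_map_inner_sphereUniform_prod {d : ℕ} [NeZero d]
    {ν : Measure (EuclideanSpace ℝ (Fin d))} [IsProbabilityMeasure ν] (hν : RotationInvariant ν)
    (hν1 : ∀ᵐ v ∂ν, ‖v‖ = 1)
    (f : BoundedContinuousFunction ℝ ℝ) {e : EuclideanSpace ℝ (Fin d)} (he : ‖e‖ = 1) :
    ∫ x, f x ∂(Measure.map
        (fun p : sphere (0 : EuclideanSpace ℝ (Fin d)) 1 ×
            sphere (0 : EuclideanSpace ℝ (Fin d)) 1 =>
          Real.sqrt d * ⟪(p.1 : EuclideanSpace ℝ (Fin d)), (p.2 : EuclideanSpace ℝ (Fin d))⟫)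
        ((sphereUniform d).prod (sphereUniform d))) =
      ∫ v, f (Real.sqrt d * ⟪e, v⟫) ∂ν := by
  set σ : Measure (EuclideanSpace ℝ (Fin d)) := (sphereUniform d).map Subtype.val with hσ
  have : IsProbabilityMeasure σ := Measure.isProbabilityMeasure_map (by fun_prop)
  have hσ_inv : RotationInvariant σ := by
    rw [hσ, sphereUniform, Measure.map_smul]
    exact rotationInvariant_toSphere_map_coe.smul _
  have hσ1 : ∀ᵐ v ∂σ, ‖v‖ = 1 :=
    (ae_map_iff (by fun_prop) (measurableSet_eq_fun (by fun_prop) (by fun_prop))).2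
      (ae_of_all _ fun v ↦ by simp)
  set g : BoundedContinuousFunction ℝ ℝ :=
    f.compContinuous ⟨fun t ↦ Real.sqrt d * t, by fun_prop⟩
  rw [integral_map (Continuous.aemeasurable (by fun_prop)) (by fun_prop)]
  change ∫ p, g ⟪_, _⟫ ∂_ = ∫ v, g ⟪e, v⟫ ∂ν
  rw [← hσ_inv.integral_inner_unique hν hσ1 hν1 g he, ← hσ_inv.integral_prod_inner g hσ1 he,
    ← integral_prod (f := fun p : EuclideanSpace ℝ (Fin d) × EuclideanSpace ℝ (Fin d) ↦
      g ⟪p.1, p.2⟫), hσ, Measure.map_prod_map _ _ (by fun_prop) (by fun_prop), integral_map]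
  · rfl
  · fun_prop
  · exact Continuous.aestronglyMeasurable (by fun_prop)
  · exact Integrable.of_bound (C := ‖g‖) (Continuous.aestronglyMeasurable (by fun_prop))
      (ae_of_all _ fun p ↦ g.norm_coe_le_norm _)

lemma integral_sq_gaussianReal_zero_one : ∫ x, x ^ 2 ∂(gaussianReal 0 1) = 1 := by
  rw [← variance_of_integral_eq_zero (X := fun x ↦ x) (by fun_prop) (by simp)]
  simp

/-- The law of `√d * ⟨u, v⟩` is that of the first coordinate of a standard Gaussian vector
divided by the root mean square of its coordinates. -/
lemma integral_map_inner_sphereUniform_prod_eq_iid {Ω : Type*} [MeasurableSpace Ω] {P : Measure Ω}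
    [IsProbabilityMeasure P] {X : ℕ → Ω → ℝ} (hX : ∀ i, Measurable (X i))
    (hlaw : ∀ i, HasLaw (X i) (gaussianReal 0 1) P) (hindep : iIndepFun X P)
    (f : BoundedContinuousFunction ℝ ℝ) (d : ℕ) [NeZero d] :
    ∫ x, f x ∂(Measure.map
        (fun p : sphere (0 : EuclideanSpace ℝ (Fin d)) 1 ×
            sphere (0 : EuclideanSpace ℝ (Fin d)) 1 =>
          Real.sqrt d * ⟪(p.1 : EuclideanSpace ℝ (Fin d)), (p.2 : EuclideanSpace ℝ (Fin d))⟫)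
        ((sphereUniform d).prod (sphereUniform d))) =
      ∫ ω, f ((Real.sqrt ((∑ i ∈ Finset.range d, X i ω ^ 2) / d))⁻¹ * X 0 ω) ∂P := by
  set Y : Ω → EuclideanSpace ℝ (Fin d) := fun ω ↦ WithLp.toLp 2 fun i ↦ X i ω with hY
  have hYm : Measurable Y := by fun_prop
  have hN : Measurable fun x : EuclideanSpace ℝ (Fin d) ↦ ‖x‖⁻¹ • x := by fun_prop
  have hY_law : P.map Y = stdGaussian (EuclideanSpace ℝ (Fin d)) := by
    rw [← map_pi_eq_stdGaussian, ← funext fun i : Fin d ↦ (hlaw i).map_eq,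
      ← iIndepFun.map_fun_eq_pi_map (f := fun (i : Fin d) ω ↦ X i ω)
        (fun i ↦ (hX i).aemeasurable) (hindep.precomp Fin.val_injective),
      Measure.map_map (by fun_prop) (by fun_prop)]
    rfl
  have hne : ∀ᵐ ω ∂P, X 0 ω ≠ 0 := by
    have := nullSingletonClass_gaussianReal (μ := 0) (v := 1) one_ne_zero
    rw [(hlaw 0).ae_iff (p := fun x ↦ x ≠ 0) (by fun_prop)]
    exact Measure.ae_ne _ _
  have hY1 : ∀ᵐ v ∂((P.map Y).map fun x ↦ ‖x‖⁻¹ • x), ‖v‖ = 1 := by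
    have hm : MeasurableSet {v : EuclideanSpace ℝ (Fin d) | ‖v‖ = 1} :=
      measurableSet_eq_fun (by fun_prop) (by fun_prop)
    rw [ae_map_iff hN.aemeasurable hm,
      ae_map_iff (p := fun x ↦ ‖‖x‖⁻¹ • x‖ = 1) hYm.aemeasurable (hN hm)]
    filter_upwards [hne] with ω hω
    have : Y ω ≠ 0 := fun h ↦ hω (by simpa [hY] using congr_arg (fun y ↦ y 0) h)
    simp [norm_smul, this]
  have : IsProbabilityMeasure ((P.map Y).map fun x ↦ ‖x‖⁻¹ • x) := by
    have := Measure.isProbabilityMeasure_map (μ := P) hYm.aemeasurable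
    exact Measure.isProbabilityMeasure_map hN.aemeasurable
  rw [integral_map_inner_sphereUniform_prod
    (hY_law ▸ rotationInvariant_stdGaussian.map_normalize) hY1 f
    (e := EuclideanSpace.single 0 1) (by simp), Measure.map_map hN hYm,
    integral_map (hN.comp hYm).aemeasurable (Continuous.aestronglyMeasurable (by fun_prop))]
  refine integral_congr_ae (ae_of_all _ fun ω ↦ ?_)
  have hnorm : ‖Y ω‖ = Real.sqrt (∑ i ∈ Finset.range d, X i ω ^ 2) := by
    rw [EuclideanSpace.norm_eq, ← Fin.sum_univ_eq_sum_range (fun i ↦ X i ω ^ 2)]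
    simp [hY]
  simp only [Function.comp_apply, EuclideanSpace.inner_single_left, PiLp.smul_apply, hnorm,
    Real.sqrt_div' _ (Nat.cast_nonneg d)]
  congr 1
  simp [hY]
  ring

/-- If `u, v` are independent uniform random points on the unit sphere
`S^{d-1} ⊂ ℝ^d`, then `√d · ⟨u, v⟩` converges in distribution to `N(0,1)` as `d → ∞`:
the pushforward measures of `σ_d ⊗ σ_d` under `(u,v) ↦ √d·⟨u,v⟩` converge weakly to the
standard Gaussian measure on `ℝ`. -/
theorem sqrt_dim_inner_sphere_tendsto_gaussian :
    ∀ f : BoundedContinuousFunction ℝ ℝ,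
      Tendsto (fun d : ℕ =>
          ∫ x, f x ∂(Measure.map
            (fun p : sphere (0 : EuclideanSpace ℝ (Fin d)) 1 ×
                     sphere (0 : EuclideanSpace ℝ (Fin d)) 1 =>
              Real.sqrt d * ⟪(p.1 : EuclideanSpace ℝ (Fin d)), (p.2 : EuclideanSpace ℝ (Fin d))⟫)
            ((sphereUniform d).prod (sphereUniform d))))
        atTop (nhds (∫ x, f x ∂(ProbabilityTheory.gaussianReal 0 1))) := by
  intro f
  obtain ⟨Ω, _, P, X, hX, hlaw, hindep, _⟩ := exists_iid ℕ (gaussianReal 0 1)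
  have hslln : ∀ᵐ ω ∂P,
      Tendsto (fun n : ℕ ↦ (∑ i ∈ Finset.range n, X i ω ^ 2) / n) atTop (nhds 1) := by
    have hsq : Integrable (fun x : ℝ ↦ x ^ 2) (gaussianReal 0 1) :=
      (memLp_id_gaussianReal 2).integrable_sq
    have hmean : ∫ ω, X 0 ω ^ 2 ∂P = 1 := by
      rw [← integral_sq_gaussianReal_zero_one]
      exact (hlaw 0).integral_comp (f := fun x ↦ x ^ 2) (by fun_prop)
    rw [← hmean]
    refine strong_law_ae_real (fun i ω ↦ X i ω ^ 2) ?_ (fun i j hij ↦ ?_) fun i ↦ ?_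
    · exact ((hlaw 0).measurePreserving (hX 0)).integrable_comp_of_integrable hsq
    · exact (hindep.indepFun hij).comp (φ := fun x ↦ x ^ 2) (ψ := fun x ↦ x ^ 2)
        (by fun_prop) (by fun_prop)
    · exact IdentDistrib.comp (u := fun x ↦ x ^ 2)
        ⟨(hX i).aemeasurable, (hX 0).aemeasurable, (hlaw i).map_eq.trans (hlaw 0).map_eq.symm⟩
        (by fun_prop)
  have hlim : ∫ x, f x ∂(gaussianReal 0 1) = ∫ ω, f (X 0 ω) ∂P :=
    ((hlaw 0).integral_comp (by fun_prop)).symm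
  rw [hlim, ← tendsto_add_atTop_iff_nat 1]
  simp_rw [fun d : ℕ ↦ integral_map_inner_sphereUniform_prod_eq_iid hX hlaw hindep f (d + 1)]
  refine tendsto_integral_of_dominated_convergence (fun _ ↦ ‖f‖) (fun d ↦ ?_)
    (integrable_const _) (fun d ↦ ae_of_all _ fun ω ↦ f.norm_coe_le_norm _) ?_
  · exact f.continuous.measurable.comp (by fun_prop) |>.aestronglyMeasurable
  · filter_upwards [hslln] with ω hω
    have hω' := (tendsto_add_atTop_iff_nat 1).2 hω
    simpa [Function.comp_def] using (f.continuous.tendsto _).comp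
      ((hω'.sqrt.inv₀ (by simp)).mul_const (X 0 ω))
end

section
/- For each dimension d, let u and v be independent random vectors, each distributed according to the uniform (normalized surface) probability measure on the unit sphere S^{d−1} ⊂ ℝ^d. Then the real random variable √d · ((180/π)·arccos⟨u,v⟩ − 90) converges in distribution, as d → ∞, to the normal distribution N(0, (180/π)²); equivalently, the pushforward measures of σ_d ⊗ σ_d under (u,v) ↦ √d·((180/π)·arccos⟨u,v⟩ − 90) converge weakly to the Gaussian measure on ℝ with mean 0 and variance (180/π)². -/
open MeasureTheory Filter Metric RealInnerProductSpace

open ProbabilityTheory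

instance sphereUniform.isProbabilityMeasure (d : ℕ) [NeZero d] :
    IsProbabilityMeasure (sphereUniform d) := by
  have : Nontrivial (EuclideanSpace ℝ (Fin d)) := by
    apply Module.nontrivial_of_finrank_pos (R := ℝ)
    simpa using Nat.pos_of_neZero d
  constructor
  rw [sphereUniform, Measure.smul_apply, smul_eq_mul, ENNReal.inv_mul_cancel]
  · exact Measure.measure_univ_ne_zero.2 (Measure.toSphere_ne_zero _)
  · exact measure_ne_top _ _

theorem exists_linearIsometryEquiv_apply_eq {E : Type*} [NormedAddCommGroup E]
    [InnerProductSpace ℝ E] {v w : E} (h : ‖v‖ = ‖w‖) : ∃ R : E ≃ₗᵢ[ℝ] E, R v = w :=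
  ⟨_, Submodule.reflection_sub h⟩

theorem sphereUniform_map_inner_eq {d : ℕ} {v w : EuclideanSpace ℝ (Fin d)} (h : ‖v‖ = ‖w‖) :
    (sphereUniform d).map
        (fun u : sphere (0 : EuclideanSpace ℝ (Fin d)) 1 => ⟪(u : EuclideanSpace ℝ (Fin d)), v⟫) =
      (sphereUniform d).map
        (fun u : sphere (0 : EuclideanSpace ℝ (Fin d)) 1 => ⟪(u : EuclideanSpace ℝ (Fin d)), w⟫) := by
  obtain ⟨R, rfl⟩ := exists_linearIsometryEquiv_apply_eq h
  ext s hs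
  have hmeas : ∀ z : EuclideanSpace ℝ (Fin d), Measurable
      (fun u : sphere (0 : EuclideanSpace ℝ (Fin d)) 1 =>
        ⟪(u : EuclideanSpace ℝ (Fin d)), z⟫) := fun z => by fun_prop
  rw [Measure.map_apply (hmeas _) hs, Measure.map_apply (hmeas _) hs, sphereUniform,
    Measure.smul_apply, Measure.smul_apply, Measure.toSphere_apply' _ (hmeas _ hs),
    Measure.toSphere_apply' _ (hmeas _ hs)]
  symm
  rw [← R.measurePreserving.measure_preimage_emb R.toHomeomorph.measurableEmbedding]
  congr 3
  ext x
  simp only [Set.mem_preimage, Set.mem_smul, Set.mem_image, Subtype.exists, mem_sphere_iff_norm,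
    sub_zero, exists_and_right, exists_eq_right]
  constructor
  · rintro ⟨r, hr, y, ⟨hy, hys⟩, hyx⟩
    refine ⟨r, hr, R.symm y, ⟨by simpa using hy, ?_⟩, ?_⟩
    · rwa [← R.inner_map_map, R.apply_symm_apply]
    · rw [← map_smul, hyx, R.symm_apply_apply]
  · rintro ⟨r, hr, y, ⟨hy, hys⟩, rfl⟩
    exact ⟨r, hr, R y, ⟨by simpa using hy, by simpa using hys⟩, by simp⟩

theorem stdGaussian_map_inner_div_norm_eq {E : Type*} [NormedAddCommGroup E]
    [InnerProductSpace ℝ E] [FiniteDimensional ℝ E] [MeasurableSpace E] [BorelSpace E]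
    {v w : E} (h : ‖v‖ = ‖w‖) :
    (stdGaussian E).map (fun x => ⟪v, x⟫ / ‖x‖) = (stdGaussian E).map (fun x => ⟪w, x⟫ / ‖x‖) := by
  obtain ⟨R, rfl⟩ := exists_linearIsometryEquiv_apply_eq h
  conv_rhs => rw [← stdGaussian_map R, Measure.map_map (by fun_prop) R.continuous.measurable]
  simp [Function.comp_def]

theorem integral_stdGaussian_inner_div_norm_eq {E : Type*} [NormedAddCommGroup E]
    [InnerProductSpace ℝ E] [FiniteDimensional ℝ E] [MeasurableSpace E] [BorelSpace E]
    {v w : E} (h : ‖v‖ = ‖w‖) {F : ℝ → ℝ} (hF : Measurable F) :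
    ∫ x, F (⟪v, x⟫ / ‖x‖) ∂(stdGaussian E) = ∫ x, F (⟪w, x⟫ / ‖x‖) ∂(stdGaussian E) := by
  have := congrArg (fun m => ∫ t, F t ∂m) (stdGaussian_map_inner_div_norm_eq h)
  rwa [integral_map (by fun_prop) hF.aestronglyMeasurable,
    integral_map (by fun_prop) hF.aestronglyMeasurable] at this

theorem stdGaussian_ae_ne_zero {d : ℕ} [NeZero d] :
    ∀ᵐ x ∂(stdGaussian (EuclideanSpace ℝ (Fin d))), x ≠ 0 := by
  rw [← map_pi_eq_stdGaussian, ae_map_iff (by fun_prop)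
    (p := fun x => x ≠ 0) (measurableSet_singleton (0 : EuclideanSpace ℝ (Fin d))).compl]
  have := nullSingletonClass_gaussianReal (μ := 0) (v := 1) one_ne_zero
  have h0 : (Measure.pi fun _ : Fin d => gaussianReal 0 1) {0} = 0 := by
    rw [Measure.pi_singleton]
    simp [NeZero.ne d]
  filter_upwards [compl_mem_ae_iff.2 h0] with x hx
  simpa using hx

theorem integral_sphereUniform_inner (d : ℕ) [NeZero d] (e : EuclideanSpace ℝ (Fin d))
    (he : ‖e‖ = 1) (F : BoundedContinuousFunction ℝ ℝ) :
    ∫ u, F ⟪(u : EuclideanSpace ℝ (Fin d)), e⟫ ∂(sphereUniform d) =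
      ∫ x, F (⟪e, x⟫ / ‖x‖) ∂(stdGaussian (EuclideanSpace ℝ (Fin d))) := by
  set γ := stdGaussian (EuclideanSpace ℝ (Fin d))
  have hF : Measurable F := F.continuous.measurable
  have hmeas : ∀ z : EuclideanSpace ℝ (Fin d), Measurable
      (fun u : sphere (0 : EuclideanSpace ℝ (Fin d)) 1 =>
        ⟪(u : EuclideanSpace ℝ (Fin d)), z⟫) := fun z => by fun_prop
  have h1 : ∀ᵐ x ∂γ, ∫ u, F (⟪(u : EuclideanSpace ℝ (Fin d)), x⟫ / ‖x‖) ∂(sphereUniform d) =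
      ∫ u, F ⟪(u : EuclideanSpace ℝ (Fin d)), e⟫ ∂(sphereUniform d) := by
    filter_upwards [stdGaussian_ae_ne_zero] with x hx
    have hn : ‖(‖x‖⁻¹ • x)‖ = ‖e‖ := by
      rw [he, norm_smul, norm_inv, norm_norm, inv_mul_cancel₀ (norm_ne_zero_iff.2 hx)]
    have := congrArg (fun m => ∫ t, F t ∂m) (sphereUniform_map_inner_eq hn)
    rw [integral_map (hmeas _).aemeasurable hF.aestronglyMeasurable,
      integral_map (hmeas _).aemeasurable hF.aestronglyMeasurable] at this
    simpa only [inner_smul_right, inv_mul_eq_div] using this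
  have h2 : ∀ u : sphere (0 : EuclideanSpace ℝ (Fin d)) 1,
      ∫ x, F (⟪(u : EuclideanSpace ℝ (Fin d)), x⟫ / ‖x‖) ∂γ = ∫ x, F (⟪e, x⟫ / ‖x‖) ∂γ := by
    intro u
    have hn : ‖(u : EuclideanSpace ℝ (Fin d))‖ = ‖e‖ := by simp [he]
    exact integral_stdGaussian_inner_div_norm_eq hn hF
  have hint : Integrable (Function.uncurry fun (u : sphere (0 : EuclideanSpace ℝ (Fin d)) 1) x =>
      F (⟪(u : EuclideanSpace ℝ (Fin d)), x⟫ / ‖x‖)) ((sphereUniform d).prod γ) := by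
    refine Integrable.of_bound (C := ‖F‖) ?_ (ae_of_all _ fun _ => F.norm_coe_le_norm _)
    apply Measurable.aestronglyMeasurable
    unfold Function.uncurry
    fun_prop
  have h3 := integral_integral_swap hint
  rw [integral_congr_ae h1] at h3
  simpa [h2] using h3.symm

theorem integral_sphereUniform_prod_inner (d : ℕ) [NeZero d] (e : EuclideanSpace ℝ (Fin d))
    (he : ‖e‖ = 1) (F : BoundedContinuousFunction ℝ ℝ) :
    ∫ p, F ⟪(p.1 : EuclideanSpace ℝ (Fin d)), (p.2 : EuclideanSpace ℝ (Fin d))⟫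
        ∂((sphereUniform d).prod (sphereUniform d)) =
      ∫ x, F (⟪e, x⟫ / ‖x‖) ∂(stdGaussian (EuclideanSpace ℝ (Fin d))) := by
  have hF : Measurable F := F.continuous.measurable
  rw [integral_prod_symm]
  · simp only
    have : ∀ v : sphere (0 : EuclideanSpace ℝ (Fin d)) 1,
        ∫ u, F ⟪(u : EuclideanSpace ℝ (Fin d)), (v : EuclideanSpace ℝ (Fin d))⟫
          ∂(sphereUniform d) =
        ∫ x, F (⟪e, x⟫ / ‖x‖) ∂(stdGaussian (EuclideanSpace ℝ (Fin d))) := by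
      intro v
      rw [integral_sphereUniform_inner d v (by simp)]
      exact integral_stdGaussian_inner_div_norm_eq (by simp [he]) hF
    simp [this]
  · refine Integrable.of_bound (C := ‖F‖) ?_ (ae_of_all _ fun _ => F.norm_coe_le_norm _)
    apply Measurable.aestronglyMeasurable
    fun_prop

theorem tendsto_mul_of_hasDerivAt_zero {g : ℝ → ℝ} {g' L : ℝ} {a t : ℕ → ℝ}
    (hg : HasDerivAt g g' 0) (hg0 : g 0 = 0) (ht : Tendsto t atTop (nhds 0))
    (hat : Tendsto (fun n => a n * t n) atTop (nhds L)) :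
    Tendsto (fun n => a n * g (t n)) atTop (nhds (L * g')) := by
  have hd : Tendsto (dslope g 0) (nhds 0) (nhds g') := by
    have := (continuousAt_dslope_same.2 hg.differentiableAt).tendsto
    rwa [dslope_same, hg.deriv] at this
  refine (hat.mul (hd.comp ht)).congr fun n => ?_
  have := sub_smul_dslope g 0 (t n)
  simp only [sub_zero, hg0, smul_eq_mul] at this
  rw [Function.comp_apply, mul_assoc, this]

theorem infinitePi_gaussianReal_ae_tendsto_sum_sq_div :
    ∀ᵐ ω ∂(Measure.infinitePi fun _ : ℕ => gaussianReal 0 1),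
      Tendsto (fun n : ℕ => (∑ i ∈ Finset.range n, ω i ^ 2) / (n : ℝ)) atTop (nhds 1) := by
  have hlaw : ∀ i, MeasurePreserving (fun ω : ℕ → ℝ => ω i)
      (Measure.infinitePi fun _ : ℕ => gaussianReal 0 1) (gaussianReal 0 1) :=
    fun i => measurePreserving_eval_infinitePi _ i
  have hsq : Integrable (fun x : ℝ => x ^ 2) (gaussianReal 0 1) :=
    (memLp_id_gaussianReal 2).integrable_sq
  have hone : ∫ x, x ^ 2 ∂(gaussianReal 0 1) = 1 := by
    have := variance_fun_id_gaussianReal (μ := 0) (v := 1)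
    rwa [variance_of_integral_eq_zero (by fun_prop) (by simp)] at this
  have key := strong_law_ae_real (μ := Measure.infinitePi fun _ : ℕ => gaussianReal 0 1)
    (fun i ω => ω i ^ 2) ((hlaw 0).integrable_comp_of_integrable hsq)
    (fun i j hij => (iIndepFun_infinitePi (X := fun _ x => x ^ 2) (by fun_prop)).indepFun hij)
    (fun i => IdentDistrib.comp (u := fun x : ℝ => x ^ 2)
      ⟨(hlaw i).aemeasurable, (hlaw 0).aemeasurable, by rw [(hlaw i).map_eq, (hlaw 0).map_eq]⟩ (by fun_prop))
  have hmean : ∫ ω : ℕ → ℝ, ω 0 ^ 2 ∂(Measure.infinitePi fun _ : ℕ => gaussianReal 0 1) = 1 := by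
    rw [← hone]
    have := integral_map (hlaw 0).aemeasurable
      (f := fun x : ℝ => x ^ 2) (Measurable.aestronglyMeasurable (by fun_prop))
    rw [← this, (hlaw 0).map_eq]
  rwa [hmean] at key

theorem integral_sphereUniform_prod_eq_integral_infinitePi (d : ℕ) [NeZero d]
    (F : BoundedContinuousFunction ℝ ℝ) :
    ∫ p, F ⟪(p.1 : EuclideanSpace ℝ (Fin d)), (p.2 : EuclideanSpace ℝ (Fin d))⟫
        ∂((sphereUniform d).prod (sphereUniform d)) =
      ∫ ω : ℕ → ℝ, F (ω 0 / √(∑ i ∈ Finset.range d, ω i ^ 2))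
        ∂(Measure.infinitePi fun _ : ℕ => gaussianReal 0 1) := by
  have hF : Measurable F := F.continuous.measurable
  rw [integral_sphereUniform_prod_inner d (EuclideanSpace.single 0 1) (by simp),
    ← map_pi_eq_stdGaussian, ← Measure.infinitePi_eq_pi,
    ← Measure.map_infinitePi_infinitePi_of_inj (P := fun _ : ℕ => gaussianReal 0 1)
      (Fin.val_injective (n := d)),
    Measure.map_map (by fun_prop) (by fun_prop),
    integral_map (Measurable.aemeasurable (by fun_prop))
      (Measurable.aestronglyMeasurable (by fun_prop))]
  simp [EuclideanSpace.norm_eq, Finset.sum_range, EuclideanSpace.inner_single_left]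

theorem sqrt_mul_degrees_arccos_sub_ninety (d t : ℝ) :
    √d * (180 / Real.pi * Real.arccos t - 90) = -(180 / Real.pi) * (√d * Real.arcsin t) := by
  rw [Real.arccos]
  field_simp
  ring

theorem tendsto_sqrt_mul_degrees_arccos_sub_ninety {x : ℝ} {S : ℕ → ℝ}
    (hS : Tendsto (fun n : ℕ => S n / n) atTop (nhds 1)) :
    Tendsto (fun n : ℕ => √n * (180 / Real.pi * Real.arccos (x / √(S n)) - 90)) atTop
      (nhds (-(180 / Real.pi) * x)) := by
  have hat : Tendsto (fun n : ℕ => √n * (x / √(S n))) atTop (nhds x) := by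
    have h : Tendsto (fun n : ℕ => x / √(S n / n)) atTop (nhds (x / √1)) :=
      tendsto_const_nhds.div hS.sqrt (by simp)
    rw [Real.sqrt_one, div_one] at h
    refine h.congr fun n => ?_
    rw [Real.sqrt_div' _ n.cast_nonneg, div_div_eq_mul_div]
    ring
  have ht : Tendsto (fun n : ℕ => x / √(S n)) atTop (nhds 0) := by
    have h0 : Tendsto (fun n : ℕ => (√(n : ℝ))⁻¹) atTop (nhds 0) :=
      (Real.tendsto_sqrt_atTop.comp tendsto_natCast_atTop_atTop).inv_tendsto_atTop
    have h := h0.mul hat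
    rw [zero_mul] at h
    refine h.congr' ?_
    filter_upwards [eventually_gt_atTop 0] with n hn
    have : √(n : ℝ) ≠ 0 := by positivity
    rw [inv_mul_cancel_left₀ this]
  have hderiv : HasDerivAt Real.arcsin 1 0 := by
    simpa using Real.hasDerivAt_arcsin (x := 0) (by norm_num) (by norm_num)
  have h := tendsto_mul_of_hasDerivAt_zero hderiv Real.arcsin_zero ht hat
  rw [mul_one] at h
  simpa only [sqrt_mul_degrees_arccos_sub_ninety] using h.const_mul (-(180 / Real.pi))

theorem integral_infinitePi_gaussianReal_neg_mul (c : ℝ) (f : BoundedContinuousFunction ℝ ℝ) :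
    ∫ ω : ℕ → ℝ, f (-c * ω 0) ∂(Measure.infinitePi fun _ : ℕ => gaussianReal 0 1) =
      ∫ x, f x ∂(gaussianReal 0 (c ^ 2 : ℝ).toNNReal) := by
  have h : (gaussianReal 0 1).map (-c * ·) = gaussianReal 0 (c ^ 2 : ℝ).toNNReal := by
    rw [gaussianReal_map_const_mul, mul_zero, mul_one]
    congr 1
    ext
    simp [Real.coe_toNNReal _ (sq_nonneg c)]
  have h0 := (measurePreserving_eval_infinitePi (fun _ : ℕ => gaussianReal 0 1) 0).map_eq
  rw [← h, integral_map (by fun_prop) f.continuous.measurable.aestronglyMeasurable]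
  have hf : Measurable fun x => f (-c * x) := f.continuous.measurable.comp (by fun_prop)
  have := integral_map (measurable_pi_apply 0).aemeasurable
    (μ := Measure.infinitePi fun _ : ℕ => gaussianReal 0 1) hf.aestronglyMeasurable
  change _ = ∫ ω : ℕ → ℝ, f (-c * ω 0) ∂_ at this
  rw [← this]
  exact congrArg (fun m => ∫ x, f (-c * x) ∂m) h0

/-- If `u, v` are independent uniform random points on the unit sphere
`S^{d-1} ⊂ ℝ^d`, then the degree-angle fluctuation `√d·((180/π)·arccos⟨u,v⟩ − 90)`
converges in distribution to `N(0, (180/π)²)` as `d → ∞`: the pushforward measures of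
`σ_d ⊗ σ_d` under `(u,v) ↦ √d·((180/π)·arccos⟨u,v⟩ − 90)` converge weakly to the centered
Gaussian measure on `ℝ` with variance `(180/π)²`. -/
theorem sqrt_dim_angle_sphere_tendsto_gaussian :
    ∀ f : BoundedContinuousFunction ℝ ℝ,
      Tendsto (fun d : ℕ =>
          ∫ x, f x ∂(Measure.map
            (fun p : sphere (0 : EuclideanSpace ℝ (Fin d)) 1 ×
                     sphere (0 : EuclideanSpace ℝ (Fin d)) 1 =>
              Real.sqrt d *
                ((180 / Real.pi) *
                    Real.arccos
                      ⟪(p.1 : EuclideanSpace ℝ (Fin d)), (p.2 : EuclideanSpace ℝ (Fin d))⟫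
                  - 90))
            ((sphereUniform d).prod (sphereUniform d))))
        atTop
        (nhds (∫ x, f x
          ∂(ProbabilityTheory.gaussianReal 0 (((180 / Real.pi) ^ 2 : ℝ).toNNReal)))) := by
  intro f
  rw [← integral_infinitePi_gaussianReal_neg_mul]
  have hrewrite : ∀ d : ℕ, 0 < d →
      ∫ x, f x ∂(Measure.map
        (fun p : sphere (0 : EuclideanSpace ℝ (Fin d)) 1 ×
                 sphere (0 : EuclideanSpace ℝ (Fin d)) 1 =>
          Real.sqrt d * ((180 / Real.pi) * Real.arccos
            ⟪(p.1 : EuclideanSpace ℝ (Fin d)), (p.2 : EuclideanSpace ℝ (Fin d))⟫ - 90))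
        ((sphereUniform d).prod (sphereUniform d))) =
      ∫ ω : ℕ → ℝ, f (√d * (180 / Real.pi *
          Real.arccos (ω 0 / √(∑ i ∈ Finset.range d, ω i ^ 2)) - 90))
        ∂(Measure.infinitePi fun _ : ℕ => gaussianReal 0 1) := by
    intro d hd
    have : NeZero d := ⟨hd.ne'⟩
    have hcont : Continuous fun t : ℝ => √d * (180 / Real.pi * Real.arccos t - 90) := by
      fun_prop
    rw [integral_map (Measurable.aemeasurable (by fun_prop))
      f.continuous.measurable.aestronglyMeasurable]
    exact integral_sphereUniform_prod_eq_integral_infinitePi d (f.compContinuous ⟨_, hcont⟩)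
  have hf : Measurable f := f.continuous.measurable
  refine Tendsto.congr' (f₁ := fun d : ℕ => ∫ ω : ℕ → ℝ, f (√d * (180 / Real.pi *
      Real.arccos (ω 0 / √(∑ i ∈ Finset.range d, ω i ^ 2)) - 90))
    ∂(Measure.infinitePi fun _ : ℕ => gaussianReal 0 1)) ?_ ?_
  · filter_upwards [eventually_gt_atTop 0] with d hd
    exact (hrewrite d hd).symm
  · refine tendsto_integral_of_dominated_convergence (fun _ => ‖f‖) (fun d => ?_)
      (integrable_const _) (fun d => ae_of_all _ fun _ => f.norm_coe_le_norm _) ?_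
    · exact Measurable.aestronglyMeasurable (by fun_prop)
    · filter_upwards [infinitePi_gaussianReal_ae_tendsto_sum_sq_div] with ω hω
      exact (f.continuous.tendsto _).comp (tendsto_sqrt_mul_degrees_arccos_sub_ninety hω)
end

section
/- Let p_1, …, p_N be vectors in ℝ^d and let w ∈ ℝ^d be such that p_i ≠ w for all i. Set x_i = (p_i − w)/‖p_i − w‖ and suppose ∑_{i=1}^N x_i ≠ 0 and that the unit directions x_1, …, x_N do not all lie on a single line through the origin (i.e., it is not the case that every x_i equals ±x_1). Then there exists η > 0 such that for all ε ∈ (0, η], ‖ ∑_{j=1}^N (p_j − w − ε·∑_{i=1}^N x_i) / ‖p_j − w − ε·∑_{i=1}^N x_i‖ ‖ < ‖ ∑_{i=1}^N x_i ‖. -/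
open scoped RealInnerProductSpace

section Concentration

variable {E : Type*} [NormedAddCommGroup E] [InnerProductSpace ℝ E]

theorem hasDerivAt_inv_norm_smul_sub_smul {v : E} (hv : v ≠ 0) (s : E) :
    HasDerivAt (fun ε : ℝ => ‖v - ε • s‖⁻¹ • (v - ε • s))
      (‖v‖⁻¹ • (⟪‖v‖⁻¹ • v, s⟫ • (‖v‖⁻¹ • v) - s)) 0 := by
  have hn : ‖v‖ ≠ 0 := norm_ne_zero_iff.mpr hv
  have h1 : HasDerivAt (fun ε : ℝ => v - ε • s) (-s) 0 := by
    simpa using ((hasDerivAt_id (0 : ℝ)).smul_const s).const_sub v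
  have h2 := h1.norm_sq.sqrt (by simpa using hv)
  simp only [Real.sqrt_sq (norm_nonneg _)] at h2
  have h3 := (h2.fun_inv (by simpa using hv)).fun_smul h1
  convert h3 using 1
  simp only [zero_smul, sub_zero, inner_neg_right, inner_smul_left, smul_sub, smul_smul, smul_neg,
    RCLike.conj_to_real]
  rw [sub_eq_add_neg, add_comm]
  congr 2
  field_simp

theorem eventually_lt_of_hasDerivAt_neg {f : ℝ → ℝ} {f' a : ℝ} (hf : HasDerivAt f f' a)
    (hf' : f' < 0) : ∀ᶠ t in nhdsWithin a (Set.Ioi a), f t < f a := by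
  have h := (hasDerivAt_iff_tendsto_slope.mp hf).mono_left
    (nhdsWithin_mono a fun t (ht : a < t) => ht.ne')
  filter_upwards [h.eventually_lt_const hf', self_mem_nhdsWithin] with t ht hat
  have hat : 0 < t - a := sub_pos.mpr hat
  rw [slope_def_field, div_neg_iff] at ht
  rcases ht with ht | ht <;> linarith

theorem eq_or_eq_neg_inv_norm_smul_of_norm_sq_le_inner_sq {u s : E} (hu : ‖u‖ = 1) (hs : s ≠ 0)
    (h : ‖s‖ ^ 2 ≤ ⟪u, s⟫ ^ 2) : u = ‖s‖⁻¹ • s ∨ u = -(‖s‖⁻¹ • s) := by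
  have hn : 0 < ‖s‖ := norm_pos_iff.mpr hs
  have hu' : ‖‖s‖⁻¹ • s‖ = 1 := norm_smul_inv_norm (𝕜 := ℝ) hs
  have hinner : ⟪u, ‖s‖⁻¹ • s⟫ = ‖s‖⁻¹ * ⟪u, s⟫ := inner_smul_right _ _ _
  rcases le_abs.mp (abs_norm s ▸ sq_le_sq.mp h) with h | h
  · refine .inl ((inner_eq_one_iff_of_norm_eq_one (𝕜 := ℝ) hu hu').mp ?_)
    have : ⟪u, s⟫ = ‖s‖ := le_antisymm (by simpa [hu] using real_inner_le_norm u s) h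
    rw [hinner, this, inv_mul_cancel₀ hn.ne']
  · refine .inr ((inner_eq_one_iff_of_norm_eq_one (𝕜 := ℝ) hu (by rwa [norm_neg])).mp ?_)
    have : -⟪u, s⟫ = ‖s‖ := le_antisymm (by simpa [hu] using real_inner_le_norm u (-s)) h
    rw [inner_neg_right, hinner, ← mul_neg, this, inv_mul_cancel₀ hn.ne']

end Concentration

/-- Let `p 1, …, p N` be points of `ℝ^d` distinct from `w`, and let
`x i = (p i − w)/‖p i − w‖`. If `∑ x i ≠ 0` and the directions `x i` do not all lie on a
single line through the origin (not every `x i` is `± x 0`), then there is `η > 0` such that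
for every `ε ∈ (0, η]`, moving the base point by `ε ∑ x i` strictly decreases the
directional concentration:
`‖∑ⱼ (p j − w − ε ∑ᵢ x i)/‖p j − w − ε ∑ᵢ x i‖‖ < ‖∑ᵢ x i‖`
(the denominators being nonzero for such `ε`). -/
theorem step_along_mean_direction_decreases_concentration
    (d N : ℕ) (hN : 0 < N)
    (p : Fin N → EuclideanSpace ℝ (Fin d)) (w : EuclideanSpace ℝ (Fin d))
    (hpw : ∀ i, p i ≠ w)
    (x : Fin N → EuclideanSpace ℝ (Fin d))
    (hx : ∀ i, x i = ‖p i - w‖⁻¹ • (p i - w))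
    (hsum : ∑ i, x i ≠ 0)
    (hline : ¬ ∀ i, x i = x ⟨0, hN⟩ ∨ x i = -x ⟨0, hN⟩) :
    ∃ η > (0 : ℝ), ∀ ε ∈ Set.Ioc (0 : ℝ) η,
      (∀ j, p j - w - ε • ∑ i, x i ≠ 0) ∧
      ‖∑ j, ‖p j - w - ε • ∑ i, x i‖⁻¹ • (p j - w - ε • ∑ i, x i)‖ < ‖∑ i, x i‖ := by
  set s := ∑ i, x i with hs
  have hv : ∀ i, p i - w ≠ 0 := fun i => sub_ne_zero.mpr (hpw i)
  have hnorm : ∀ i, ‖x i‖ = 1 := fun i => by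
    rw [hx]; exact norm_smul_inv_norm (𝕜 := ℝ) (hv i)
  have hle : ∀ i, ⟪x i, s⟫ ^ 2 ≤ ‖s‖ ^ 2 := fun i => by
    simpa [hnorm, sq_abs] using pow_le_pow_left₀ (abs_nonneg _) (abs_real_inner_le_norm (x i) s) 2
  obtain ⟨k, hk⟩ : ∃ k, ⟪x k, s⟫ ^ 2 < ‖s‖ ^ 2 := by
    by_contra! h
    have hpm := fun i =>
      eq_or_eq_neg_inv_norm_smul_of_norm_sq_le_inner_sq (hnorm i) hsum (h i)
    refine hline fun i => ?_
    rcases hpm i with hi | hi <;> rcases hpm ⟨0, hN⟩ with h0 | h0 <;> simp [hi, h0]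
  have hF := HasDerivAt.fun_sum fun j (_ : j ∈ Finset.univ) =>
    hasDerivAt_inv_norm_smul_sub_smul (hv j) s
  have hF0 : ∑ j, ‖p j - w - (0 : ℝ) • s‖⁻¹ • (p j - w - (0 : ℝ) • s) = s := by
    simp [hs, ← hx]
  have hG := hF.norm_sq
  simp only [hF0, ← hx] at hG
  have hneg : 2 * ⟪s, ∑ j, ‖p j - w‖⁻¹ • (⟪x j, s⟫ • x j - s)⟫ < 0 := by
    have hterm : ∀ j, ⟪s, ‖p j - w‖⁻¹ • (⟪x j, s⟫ • x j - s)⟫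
        = ‖p j - w‖⁻¹ * (⟪x j, s⟫ ^ 2 - ‖s‖ ^ 2) := fun j => by
      rw [inner_smul_right, inner_sub_right, inner_smul_right, real_inner_comm (x j) s,
        real_inner_self_eq_norm_sq, sq ⟪x j, s⟫]
    rw [inner_sum, Finset.sum_congr rfl fun j _ => hterm j]
    refine mul_neg_of_pos_of_neg two_pos
      (Finset.sum_neg' (fun j _ => ?_) ⟨k, Finset.mem_univ k, ?_⟩)
    · exact mul_nonpos_of_nonneg_of_nonpos (by positivity) (sub_nonpos.mpr (hle j))
    · exact mul_neg_of_pos_of_neg (inv_pos.mpr (norm_pos_iff.mpr (hv k))) (sub_neg.mpr hk)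
  have hdec := eventually_lt_of_hasDerivAt_neg hG hneg
  have hne : ∀ᶠ ε : ℝ in nhdsWithin 0 (Set.Ioi 0), ∀ j, p j - w - ε • s ≠ 0 := by
    refine Filter.eventually_all.mpr fun j => nhdsWithin_le_nhds ?_
    have hc : Continuous fun ε : ℝ => p j - w - ε • s := by fun_prop
    exact hc.continuousAt.eventually_ne (by simpa using hv j)
  obtain ⟨η, hη, hsub⟩ := mem_nhdsGT_iff_exists_Ioc_subset.mp (hne.and hdec)
  refine ⟨η, hη, fun ε hε => ⟨(hsub hε).1, ?_⟩⟩
  have h := (hsub hε).2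
  simp only [hF0] at h
  exact lt_of_pow_lt_pow_left₀ 2 (norm_nonneg _) h
end

section
/- Let p_1, …, p_N be vectors in ℝ^d and let w ∈ ℝ^d be such that p_i ≠ w for all i. Set x_i = (p_i − w)/‖p_i − w‖, and suppose ∑_{i=1}^N x_i ≠ 0 and that x_1, …, x_N do not all lie on a single line through the origin. Then there exist ξ > 0 and η > 0 such that: for any nonzero vectors v_1, …, v_N ∈ ℝ^d satisfying ‖ ∑_{i=1}^N x_i − ∑_{i=1}^N v_i/‖v_i‖ ‖ ≤ ξ, and for all ε ∈ (0, η], one has ‖ ∑_{j=1}^N (p_j − w − ε·∑_{i=1}^N v_i/‖v_i‖) / ‖p_j − w − ε·∑_{i=1}^N v_i/‖v_i‖‖ ‖ < ‖ ∑_{i=1}^N x_i ‖. -/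
open Filter Topology

/-- A differentiable real function strictly decreases along every short enough step in a direction
close to one in which its derivative is negative. -/
theorem HasFDerivAt.eventually_lt_of_apply_neg {E : Type*} [NormedAddCommGroup E]
    [NormedSpace ℝ E] {f : E → ℝ} {f' : E →L[ℝ] ℝ} {a u : E} (hf : HasFDerivAt f f' a)
    (hu : f' u < 0) :
    ∀ᶠ z : ℝ × E in 𝓝[>] 0 ×ˢ 𝓝 u, f (a + z.1 • z.2) < f a := by
  have hfst : Tendsto (Prod.fst : ℝ × E → ℝ) (𝓝[>] 0 ×ˢ 𝓝 u) (𝓝[>] 0) := tendsto_fst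
  have hsnd : Tendsto (Prod.snd : ℝ × E → E) (𝓝[>] 0 ×ˢ 𝓝 u) (𝓝 u) := tendsto_snd
  have hstep : Tendsto (fun z : ℝ × E => z.1 • z.2) (𝓝[>] 0 ×ˢ 𝓝 u) (𝓝 0) := by
    simpa using (hfst.mono_right nhdsWithin_le_nhds).smul hsnd
  have hlit := (hasFDerivAt_iff_isLittleO_nhds_zero.mp hf).comp_tendsto hstep
  have hc : 0 < -f' u / (4 * (‖u‖ + 1)) := by
    have := norm_nonneg u
    apply div_pos <;> linarith
  have hbound := hlit.def hc
  have hpos : ∀ᶠ z : ℝ × E in 𝓝[>] 0 ×ˢ 𝓝 u, 0 < z.1 := hfst.eventually self_mem_nhdsWithin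
  have hnorm : ∀ᶠ z : ℝ × E in 𝓝[>] 0 ×ˢ 𝓝 u, ‖z.2‖ < ‖u‖ + 1 :=
    hsnd.norm.eventually_lt_const (lt_add_one _)
  have happly : ∀ᶠ z : ℝ × E in 𝓝[>] 0 ×ˢ 𝓝 u, f' z.2 < f' u / 2 :=
    ((f'.continuous.tendsto u).comp hsnd).eventually_lt_const (by linarith)
  filter_upwards [hbound, hpos, hnorm, happly] with z h1 h2 h3 h4
  simp only [Function.comp_apply, norm_smul, Real.norm_eq_abs, _root_.abs_of_pos h2, map_smul,
    smul_eq_mul] at h1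
  have h5 : -f' u / (4 * (‖u‖ + 1)) * (z.1 * ‖z.2‖) ≤ z.1 * (-f' u / 4) := by
    calc _ ≤ -f' u / (4 * (‖u‖ + 1)) * (z.1 * (‖u‖ + 1)) := by gcongr
      _ = _ := by
        have : ‖u‖ + 1 ≠ 0 := by positivity
        field_simp
  have h6 := mul_lt_mul_of_pos_left h4 h2
  have h7 := mul_neg_of_pos_of_neg h2 hu
  have h8 := (abs_le.mp h1).2
  linarith

section InnerProductSpace

variable {E : Type*} [NormedAddCommGroup E] [InnerProductSpace ℝ E]

theorem hasDerivAt_normalize_sub_smul {q : E} (hq : q ≠ 0) (s : E) :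
    HasDerivAt (fun t : ℝ => ‖q - t • s‖⁻¹ • (q - t • s))
      (-(‖q‖⁻¹ • (s - inner ℝ (‖q‖⁻¹ • q) s • (‖q‖⁻¹ • q)))) 0 := by
  have hq' : ‖q‖ ≠ 0 := norm_ne_zero_iff.mpr hq
  have hline : HasDerivAt (fun t : ℝ => q - t • s) (-s) 0 := by
    simpa using ((hasDerivAt_id (0 : ℝ)).smul_const s).const_sub q
  have hnorm : HasDerivAt (fun t : ℝ => ‖q - t • s‖) (-(inner ℝ q s / ‖q‖)) 0 := by
    have h := hline.norm_sq.sqrt (by simpa using hq)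
    simp only [Real.sqrt_sq (norm_nonneg _), zero_smul, sub_zero, inner_neg_right] at h
    convert h using 1
    field_simp
  have h := (hnorm.fun_inv (by simpa using hq')).smul hline
  simp only [zero_smul, sub_zero] at h
  refine h.congr_deriv ?_
  rw [real_inner_smul_left]
  match_scalars <;> field_simp

theorem norm_sub_inner_smul_sq {x : E} (hx : ‖x‖ = 1) (s : E) :
    ‖s - inner ℝ x s • x‖ ^ 2 = inner ℝ s (s - inner ℝ x s • x) := by
  have h : inner ℝ x (s - inner ℝ x s • x) = 0 := by
    simp [inner_sub_right, real_inner_smul_right, hx]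
  rw [← real_inner_self_eq_norm_sq, inner_sub_left, real_inner_smul_left, h]
  simp

theorem eq_or_eq_neg_of_eq_inner_smul {x y s : E} (hx : ‖x‖ = 1) (hy : ‖y‖ = 1) (hs : s ≠ 0)
    (hsx : s = inner ℝ x s • x) (hsy : s = inner ℝ y s • y) : x = y ∨ x = -y := by
  generalize inner ℝ x s = a at hsx
  generalize inner ℝ y s = b at hsy
  have ha : |a| = ‖s‖ := by rw [hsx, norm_smul, hx, mul_one, Real.norm_eq_abs]
  have hb : |b| = ‖s‖ := by rw [hsy, norm_smul, hy, mul_one, Real.norm_eq_abs]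
  have ha0 : a ≠ 0 := by
    rintro rfl
    exact hs (by simpa using hsx)
  have hxy : a • x = b • y := hsx.symm.trans hsy
  rcases abs_eq_abs.mp (ha.trans hb.symm) with rfl | rfl
  · exact .inl (smul_right_injective E ha0 hxy)
  · refine .inr (smul_right_injective E ha0 ?_)
    simpa [neg_eq_iff_eq_neg] using hxy

end InnerProductSpace

/-- Let `p 1, …, p N` be points of `ℝ^d` distinct from `w`, and
`x i = (p i − w)/‖p i − w‖`. If `∑ x i ≠ 0` and the `x i` do not all lie on a single line
through the origin, then there exist `ξ > 0` and `η > 0` such that for any nonzero vectors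
`v 1, …, v N` whose normalized sum approximates `∑ x i` to within `ξ`, and any
`ε ∈ (0, η]`, stepping by `ε` times the normalized-gradient sum strictly decreases the
directional concentration:
`‖∑ⱼ (p j − w − ε ∑ᵢ v i/‖v i‖)/‖p j − w − ε ∑ᵢ v i/‖v i‖‖‖ < ‖∑ᵢ x i‖`
(the denominators being nonzero for such `ε`). -/
theorem step_along_approximate_mean_direction_decreases_concentration
    (d N : ℕ) (hN : 0 < N)
    (p : Fin N → EuclideanSpace ℝ (Fin d)) (w : EuclideanSpace ℝ (Fin d))
    (hpw : ∀ i, p i ≠ w)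
    (x : Fin N → EuclideanSpace ℝ (Fin d))
    (hx : ∀ i, x i = ‖p i - w‖⁻¹ • (p i - w))
    (hsum : ∑ i, x i ≠ 0)
    (hline : ¬ ∀ i, x i = x ⟨0, hN⟩ ∨ x i = -x ⟨0, hN⟩) :
    ∃ ξ > (0 : ℝ), ∃ η > (0 : ℝ),
      ∀ v : Fin N → EuclideanSpace ℝ (Fin d), (∀ i, v i ≠ 0) →
        ‖(∑ i, x i) - ∑ i, ‖v i‖⁻¹ • v i‖ ≤ ξ →
        ∀ ε ∈ Set.Ioc (0 : ℝ) η,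
          (∀ j, p j - w - ε • ∑ i, ‖v i‖⁻¹ • v i ≠ 0) ∧
          ‖∑ j, ‖p j - w - ε • ∑ i, ‖v i‖⁻¹ • v i‖⁻¹ •
              (p j - w - ε • ∑ i, ‖v i‖⁻¹ • v i)‖ < ‖∑ i, x i‖ := by
  have hq : ∀ j, p j - w ≠ 0 := fun j => sub_ne_zero.mpr (hpw j)
  have hx1 : ∀ j, ‖x j‖ = 1 := fun j => by
    rw [hx, norm_smul, norm_inv, norm_norm, inv_mul_cancel₀ (norm_ne_zero_iff.mpr (hq j))]
  set s := ∑ i, x i with hs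
  let F : EuclideanSpace ℝ (Fin d) → EuclideanSpace ℝ (Fin d) :=
    fun y => ∑ j, ‖p j - w - y‖⁻¹ • (p j - w - y)
  have hF0 : F 0 = s := by simp [F, hs, hx]
  have hFdiff : DifferentiableAt ℝ F 0 := by
    refine DifferentiableAt.fun_sum fun j _ => ?_
    have hsub : DifferentiableAt ℝ (fun y => p j - w - y) 0 := by fun_prop
    have hne : p j - w - 0 ≠ 0 := by simpa using hq j
    exact ((hsub.norm ℝ hne).fun_inv (norm_ne_zero_iff.mpr hne)).smul hsub
  have hf := (hFdiff.norm_sq ℝ).hasFDerivAt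
  have hneg : fderiv ℝ (fun y => ‖F y‖ ^ 2) 0 s < 0 := by
    have hray : HasDerivAt (fun t : ℝ => t • s) s 0 := by
      simpa using (hasDerivAt_id (0 : ℝ)).smul_const s
    have hchain : HasDerivAt (fun t : ℝ => ‖F (t • s)‖ ^ 2)
        (fderiv ℝ (fun y => ‖F y‖ ^ 2) 0 s) 0 :=
      hf.comp_hasDerivAt_of_eq (0 : ℝ) hray (zero_smul ℝ s).symm
    have hdirect := (HasDerivAt.fun_sum (u := Finset.univ) fun j _ =>
      hasDerivAt_normalize_sub_smul (hq j) s).norm_sq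
    rw [hchain.unique hdirect]
    simp only [← hx, zero_smul, sub_zero, ← hs, inner_sum, inner_neg_right,
      real_inner_smul_right _ (_ - _), ← norm_sub_inner_smul_sq (hx1 _),
      Finset.sum_neg_distrib]
    suffices h : 0 < ∑ j, ‖p j - w‖⁻¹ * ‖s - inner ℝ (x j) s • x j‖ ^ 2 by linarith
    refine (Finset.sum_nonneg fun j _ => by positivity).lt_of_ne' fun hzero => hline ?_
    have hpar : ∀ j, s = inner ℝ (x j) s • x j := fun j => by
      have hj := (Finset.sum_eq_zero_iff_of_nonneg fun j _ => by positivity).mp hzero j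
        (Finset.mem_univ j)
      simpa [norm_ne_zero_iff, hq j, sub_eq_zero, hpw j] using hj
    exact fun i => eq_or_eq_neg_of_eq_inner_smul (hx1 i) (hx1 _) hsum (hpar i) (hpar _)
  have hdesc := hf.eventually_lt_of_apply_neg hneg
  have hstep : Tendsto (fun z : ℝ × EuclideanSpace ℝ (Fin d) => z.1 • z.2)
      (𝓝[>] 0 ×ˢ 𝓝 s) (𝓝 0) := by
    simpa using (tendsto_fst.mono_right nhdsWithin_le_nhds).smul
      (tendsto_snd (f := 𝓝[>] (0 : ℝ)) (g := 𝓝 s))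
  have hnz : ∀ᶠ z : ℝ × EuclideanSpace ℝ (Fin d) in 𝓝[>] 0 ×ˢ 𝓝 s,
      ∀ j, p j - w - z.1 • z.2 ≠ 0 :=
    eventually_all.mpr fun j =>
      (tendsto_const_nhds.sub hstep).eventually_ne (by simpa using hq j)
  obtain ⟨P, hP, Q, hQ, hPQ⟩ := eventually_prod_iff.mp (hdesc.and hnz)
  obtain ⟨η, hη, hηP⟩ := mem_nhdsGT_iff_exists_Ioc_subset.mp hP
  obtain ⟨ξ, hξ, hξQ⟩ := Metric.nhds_basis_closedBall.eventually_iff.mp hQ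
  refine ⟨ξ, hξ, η, hη, fun v _ hv ε hε => ?_⟩
  obtain ⟨hlt, hne⟩ := hPQ (hηP hε) (hξQ (mem_closedBall_iff_norm'.mpr hv))
  refine ⟨hne, lt_of_pow_lt_pow_left₀ 2 (norm_nonneg _) ?_⟩
  simpa only [zero_add, hF0] using hlt
end

section
/- Let p_1, …, p_N be nonzero vectors in ℝ^d, let u ∈ ℝ^d, and set x_j = p_j/‖p_j‖. Then the function f(ε) = ‖ ∑_{j=1}^N (p_j + ε u)/‖p_j + ε u‖ ‖² is differentiable at ε = 0 with derivative f′(0) = 2 ⟨ ∑_{j=1}^N x_j , ∑_{j=1}^N (u − ⟨u, x_j⟩ x_j)/‖p_j‖ ⟩. In particular, when u = −∑_{i=1}^N x_i, f′(0) = −2 ∑_{j=1}^N (‖u‖² − ⟨u, x_j⟩²)/‖p_j‖ ≤ 0. -/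
open RealInnerProductSpace

/-- The derivative at `0` of the normalization of `p + ε • u`, for `p ≠ 0`. -/
theorem hasDerivAt_normalize_add_smul {E : Type*} [NormedAddCommGroup E] [InnerProductSpace ℝ E]
    {p : E} (hp : p ≠ 0) (u : E) :
    HasDerivAt (fun ε : ℝ => ‖p + ε • u‖⁻¹ • (p + ε • u))
      (‖p‖⁻¹ • (u - ⟪u, ‖p‖⁻¹ • p⟫ • ‖p‖⁻¹ • p)) 0 := by
  have hnorm : ‖p‖ ≠ 0 := norm_ne_zero_iff.mpr hp
  have hline : HasDerivAt (fun ε : ℝ => p + ε • u) u 0 := by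
    simpa using ((hasDerivAt_id (0 : ℝ)).smul_const u).const_add p
  have hlen : HasDerivAt (fun ε : ℝ => ‖p + ε • u‖) (⟪p, u⟫ / ‖p‖) 0 := by
    have h := hline.norm_sq.sqrt (by simpa using hp)
    simp only [zero_smul, add_zero, Real.sqrt_sq (norm_nonneg _)] at h
    convert h using 1
    field_simp
  refine ((hlen.inv (by simpa using hp)).smul hline).congr_deriv ?_
  simp only [Pi.inv_apply, zero_smul, add_zero, inner_smul_right, real_inner_comm u p]
  match_scalars <;> field_simp

/-- The Cauchy–Schwarz inequality, squared, against a normalized vector. -/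
theorem sq_inner_normalize_le {E : Type*} [NormedAddCommGroup E] [InnerProductSpace ℝ E]
    {p : E} (hp : p ≠ 0) (u : E) : ⟪u, ‖p‖⁻¹ • p⟫ ^ 2 ≤ ‖u‖ ^ 2 := by
  have h := abs_real_inner_le_norm u (‖p‖⁻¹ • p)
  have hunit : ‖‖p‖⁻¹ • p‖ = 1 := by
    rw [norm_smul, norm_inv, norm_norm, inv_mul_cancel₀ (norm_ne_zero_iff.mpr hp)]
  rw [hunit, mul_one] at h
  exact sq_le_sq.mpr (h.trans (le_abs_self _))

/-- Let `p 1, …, p N` be nonzero vectors of `ℝ^d`, `u ∈ ℝ^d`, and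
`x j = p j/‖p j‖`. Then `f(ε) = ‖∑ⱼ (p j + ε u)/‖p j + ε u‖‖²` is differentiable at
`ε = 0` with derivative `f'(0) = 2⟨∑ⱼ x j, ∑ⱼ (u − ⟨u, x j⟩ x j)/‖p j‖⟩`.
In particular, when `u = −∑ᵢ x i`, this derivative equals
`−2 ∑ⱼ (‖u‖² − ⟨u, x j⟩²)/‖p j‖ ≤ 0`. -/
theorem deriv_of_normalized_sum_sq_norm
    (d N : ℕ) (p : Fin N → EuclideanSpace ℝ (Fin d)) (hp : ∀ j, p j ≠ 0)
    (u : EuclideanSpace ℝ (Fin d))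
    (x : Fin N → EuclideanSpace ℝ (Fin d)) (hx : ∀ j, x j = ‖p j‖⁻¹ • p j) :
    HasDerivAt
        (fun ε : ℝ => ‖∑ j, ‖p j + ε • u‖⁻¹ • (p j + ε • u)‖ ^ 2)
        (2 * ⟪∑ j, x j, ∑ j, ‖p j‖⁻¹ • (u - ⟪u, x j⟫ • x j)⟫) 0 ∧
    (u = -∑ i, x i →
      2 * ⟪∑ j, x j, ∑ j, ‖p j‖⁻¹ • (u - ⟪u, x j⟫ • x j)⟫
          = -2 * ∑ j, (‖u‖ ^ 2 - ⟪u, x j⟫ ^ 2) / ‖p j‖ ∧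
      -2 * ∑ j, (‖u‖ ^ 2 - ⟪u, x j⟫ ^ 2) / ‖p j‖ ≤ 0) := by
  obtain rfl : x = fun j => ‖p j‖⁻¹ • p j := funext hx
  refine ⟨?_, fun hu => ⟨?_, ?_⟩⟩
  · simpa using (HasDerivAt.fun_sum fun j (_ : j ∈ Finset.univ) =>
      hasDerivAt_normalize_add_smul (hp j) u).norm_sq
  · rw [← neg_eq_iff_eq_neg.mpr hu, inner_neg_left, inner_sum, mul_neg, neg_mul]
    congr 2
    refine Finset.sum_congr rfl fun j _ => ?_
    rw [real_inner_smul_right, inner_sub_right, real_inner_smul_right u _ ⟪u, _⟫,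
      real_inner_self_eq_norm_sq]
    ring
  · have h : 0 ≤ ∑ j, (‖u‖ ^ 2 - ⟪u, ‖p j‖⁻¹ • p j⟫ ^ 2) / ‖p j‖ :=
      Finset.sum_nonneg fun j _ =>
        div_nonneg (sub_nonneg.mpr (sq_inner_normalize_le (hp j) u)) (norm_nonneg _)
    linarith
end

section
/- Let w₀, w, p be points in ℝ^d with w ≠ w₀, p ≠ w₀, p ≠ w, and ‖w − w₀‖ ≤ ‖p − w₀‖. Set R = ‖p − w₀‖/‖w − w₀‖ (so R ≥ 1). Then (R − 1)/(1 + R) ≤ ( ‖p − w₀‖² − ⟨p − w₀, w − w₀⟩ ) / ( ‖p − w₀‖ · ‖p − w‖ ) ≤ 1. In particular the middle quantity, which equals ⟨p − w₀, p − w⟩/(‖p − w₀‖‖p − w‖), is nonnegative and tends to 1 as R → ∞. -/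
open RealInnerProductSpace

/-- If `‖b‖ ≤ ‖a‖`, the cosine of the angle between `a` and `a - b` is at least
`(‖a‖ - ‖b‖) / (‖a‖ + ‖b‖)`. -/
theorem norm_sub_div_norm_add_le_inner_div {E : Type*} [NormedAddCommGroup E]
    [InnerProductSpace ℝ E] {a b : E} (ha : a ≠ 0) (hab : a ≠ b) (hle : ‖b‖ ≤ ‖a‖) :
    (‖a‖ - ‖b‖) / (‖a‖ + ‖b‖) ≤ ⟪a, a - b⟫ / (‖a‖ * ‖a - b‖) := by
  have ha' : 0 < ‖a‖ := norm_pos_iff.2 ha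
  have hab' : 0 < ‖a - b‖ := norm_pos_iff.2 (sub_ne_zero.2 hab)
  calc (‖a‖ - ‖b‖) / (‖a‖ + ‖b‖)
      ≤ (‖a‖ - ‖b‖) / ‖a - b‖ :=
        div_le_div_of_nonneg_left (sub_nonneg.2 hle) hab' (norm_sub_le a b)
    _ = ‖a‖ * (‖a‖ - ‖b‖) / (‖a‖ * ‖a - b‖) := (mul_div_mul_left _ _ ha'.ne').symm
    _ ≤ ⟪a, a - b⟫ / (‖a‖ * ‖a - b‖) := by
        gcongr
        rw [inner_sub_right, real_inner_self_eq_norm_sq]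
        linarith [real_inner_le_norm a b]

/-- Let `w₀, w, p ∈ ℝ^d` with `w ≠ w₀`, `p ≠ w₀`, `p ≠ w`, and
`‖w − w₀‖ ≤ ‖p − w₀‖`, and set `R = ‖p − w₀‖/‖w − w₀‖ ≥ 1`. Then
`(R − 1)/(1 + R) ≤ (‖p − w₀‖² − ⟨p − w₀, w − w₀⟩)/(‖p − w₀‖·‖p − w‖) ≤ 1`;
moreover the middle quantity equals `⟨p − w₀, p − w⟩/(‖p − w₀‖·‖p − w‖)` and is
nonnegative. -/
theorem cosine_between_directions_bounds
    (d : ℕ) (w₀ w p : EuclideanSpace ℝ (Fin d))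
    (hww₀ : w ≠ w₀) (hpw₀ : p ≠ w₀) (hpw : p ≠ w)
    (hle : ‖w - w₀‖ ≤ ‖p - w₀‖) :
    (‖p - w₀‖ / ‖w - w₀‖ - 1) / (1 + ‖p - w₀‖ / ‖w - w₀‖)
        ≤ (‖p - w₀‖ ^ 2 - ⟪p - w₀, w - w₀⟫) / (‖p - w₀‖ * ‖p - w‖) ∧
    (‖p - w₀‖ ^ 2 - ⟪p - w₀, w - w₀⟫) / (‖p - w₀‖ * ‖p - w‖) ≤ 1 ∧
    (‖p - w₀‖ ^ 2 - ⟪p - w₀, w - w₀⟫) / (‖p - w₀‖ * ‖p - w‖)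
        = ⟪p - w₀, p - w⟫ / (‖p - w₀‖ * ‖p - w‖) ∧
    0 ≤ (‖p - w₀‖ ^ 2 - ⟪p - w₀, w - w₀⟫) / (‖p - w₀‖ * ‖p - w‖) := by
  have hinner : ‖p - w₀‖ ^ 2 - ⟪p - w₀, w - w₀⟫ = ⟪p - w₀, p - w⟫ := by
    rw [← real_inner_self_eq_norm_sq, ← inner_sub_right, sub_sub_sub_cancel_right]
  have hw : 0 < ‖w - w₀‖ := norm_pos_iff.2 (sub_ne_zero.2 hww₀)
  have hratio : (‖p - w₀‖ / ‖w - w₀‖ - 1) / (1 + ‖p - w₀‖ / ‖w - w₀‖)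
      = (‖p - w₀‖ - ‖w - w₀‖) / (‖p - w₀‖ + ‖w - w₀‖) := by
    field_simp
    ring
  have hlower := norm_sub_div_norm_add_le_inner_div (sub_ne_zero.2 hpw₀)
    (fun h => hpw (sub_left_injective h)) hle
  rw [sub_sub_sub_cancel_right] at hlower
  rw [hinner, hratio]
  exact ⟨hlower, div_le_one_of_le₀ (real_inner_le_norm _ _) (by positivity), rfl,
    (div_nonneg (sub_nonneg.2 hle) (by positivity)).trans hlower⟩
end
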